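/- arXiv:math/0311469 — 3 statements merged into one kernel-verified Lean document; each statement's English description precedes it below -/
import Mathlib

section
/- Assume p_k = 1 and q_k = 0 for all but finitely many k ∈ ℤ. For every integer l ≥ 1, writing (t_l)_i := p_{i+1}·p_{i+2}·⋯·p_{i+l}, the following identity holds, all sums having only finitely many nonzero terms: (1/(2l))·Σ_{i∈ℤ} ( ‖T_l(J) e_i‖² − 2 ) − Σ_{i∈ℤ} log p_i² = (1/l)·[ (1/2)·Σ_{i∈ℤ} Σ_{j : |j−i| ≤ l−1} ⟨T_l(J) e_i, e_j⟩² + Σ_{i∈ℤ} ( (t_l)_i² − 1 − log((t_l)_i²) ) ]. -/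
open Polynomial
open scoped ENNReal RealInnerProductSpace

noncomputable section

/-- The real Hilbert space `ℓ²(ℤ)`. -/
abbrev HZ : Type := lp (fun _ : ℤ => ℝ) 2

/-- The standard orthonormal basis of `ℓ²(ℤ)`. -/
def ez (k : ℤ) : HZ := lp.single 2 k 1

/-- Chebyshev polynomials of the first kind normalized to `[-2,2]`. -/
def T : ℕ → Polynomial ℝ
  | 0 => Polynomial.C 2
  | 1 => Polynomial.X
  | (n + 2) => Polynomial.X * T (n + 1) - T n

lemma inner_ez (x : HZ) (j : ℤ) : ⟪x, ez j⟫ = x j := by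
  rw [ez, lp.inner_single_right]
  simp

lemma ez_apply (k j : ℤ) : (ez k : HZ) j = if j = k then 1 else 0 := by
  rw [ez, lp.single_apply]
  by_cases h : j = k <;> simp [h]

lemma smul_add_smul_add_smul_apply (a b c : ℝ) (x y z : HZ) (j : ℤ) :
    (a • x + b • y + c • z : HZ) j = a * x j + b * y j + c * z j := rfl

lemma norm_sq_eq_sum {x : HZ} {s : Finset ℤ} (h : ∀ j ∉ s, x j = 0) :
    ‖x‖ ^ 2 = ∑ j ∈ s, x j ^ 2 := by
  rw [← real_inner_self_eq_norm_sq, lp.inner_eq_tsum, tsum_eq_sum (s := s)]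
  · simp [sq]
  · intro j hj
    simp [h j hj]

section Jacobi

variable {p q : ℤ → ℝ} {J : HZ →L[ℝ] HZ}

lemma aeval_T_succ_succ_apply
    (hJ : ∀ k : ℤ, J (ez k) = p k • ez (k - 1) + q k • ez k + p (k + 1) • ez (k + 1))
    (n : ℕ) (i j : ℤ) :
    aeval J (T (n + 2)) (ez i) j = p i * aeval J (T (n + 1)) (ez (i - 1)) j
      + q i * aeval J (T (n + 1)) (ez i) j + p (i + 1) * aeval J (T (n + 1)) (ez (i + 1)) j
      - aeval J (T n) (ez i) j := by
  have h : T (n + 2) = T (n + 1) * X - T n := by rw [T, mul_comm]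
  rw [h, map_sub, map_mul, aeval_X, sub_apply, mul_apply_eq_comp, hJ, map_add,
    map_add, map_smul, map_smul, map_smul, lp.coeFn_sub, Pi.sub_apply,
    smul_add_smul_add_smul_apply]

lemma aeval_T_zero_apply (i j : ℤ) :
    aeval J (T 0) (ez i) j = if j = i then 2 else 0 := by
  simp [T, Algebra.algebraMap_eq_smul_one, ez_apply]

lemma aeval_T_one_apply
    (hJ : ∀ k : ℤ, J (ez k) = p k • ez (k - 1) + q k • ez k + p (k + 1) • ez (k + 1))
    (i j : ℤ) :
    aeval J (T 1) (ez i) j = (if j = i - 1 then p i else 0) + (if j = i then q i else 0)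
      + (if j = i + 1 then p (i + 1) else 0) := by
  rw [T, aeval_X, hJ, smul_add_smul_add_smul_apply]
  simp [ez_apply]

/-- The matrix of `T_n(J)` has bandwidth `n`. -/
lemma aeval_T_apply_eq_zero
    (hJ : ∀ k : ℤ, J (ez k) = p k • ez (k - 1) + q k • ez k + p (k + 1) • ez (k + 1))
    (n : ℕ) (i j : ℤ) (h : j < i - n ∨ i + n < j) :
    aeval J (T n) (ez i) j = 0 := by
  induction n using Nat.twoStepInduction generalizing i with
  | zero => rw [aeval_T_zero_apply, if_neg (by omega)]
  | one =>
    rw [aeval_T_one_apply hJ, if_neg (by omega), if_neg (by omega), if_neg (by omega)]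
    simp
  | more n ih₀ ih₁ =>
    rw [aeval_T_succ_succ_apply hJ, ih₀ i (by omega), ih₁ i (by omega), ih₁ (i - 1) (by omega),
      ih₁ (i + 1) (by omega)]
    simp

lemma aeval_T_apply_add
    (hJ : ∀ k : ℤ, J (ez k) = p k • ez (k - 1) + q k • ez k + p (k + 1) • ez (k + 1))
    (n : ℕ) (i : ℤ) :
    aeval J (T (n + 1)) (ez i) (i + (n + 1 : ℕ)) = ∏ k ∈ Finset.range (n + 1), p (i + 1 + k) := by
  induction n generalizing i with
  | zero => simp [aeval_T_one_apply hJ]; omega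
  | succ n ih =>
    rw [aeval_T_succ_succ_apply hJ, aeval_T_apply_eq_zero hJ _ (i - 1) _ (by omega),
      aeval_T_apply_eq_zero hJ _ i _ (by omega), aeval_T_apply_eq_zero hJ n i _ (by omega),
      show i + ((n + 1 + 1 : ℕ) : ℤ) = i + 1 + (n + 1 : ℕ) by push_cast; ring, ih,
      Finset.prod_range_succ' _ (n + 1)]
    simp only [mul_zero, zero_add, sub_zero, Nat.cast_zero, add_zero, mul_comm (p (i + 1))]
    congr 1
    refine Finset.prod_congr rfl fun k _ => ?_
    congr 1
    push_cast
    ring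

lemma aeval_T_apply_sub
    (hJ : ∀ k : ℤ, J (ez k) = p k • ez (k - 1) + q k • ez k + p (k + 1) • ez (k + 1))
    (n : ℕ) (i : ℤ) :
    aeval J (T (n + 1)) (ez i) (i - (n + 1 : ℕ))
      = ∏ k ∈ Finset.range (n + 1), p (i - (n + 1 : ℕ) + 1 + k) := by
  induction n generalizing i with
  | zero => simp [aeval_T_one_apply hJ]; omega
  | succ n ih =>
    rw [aeval_T_succ_succ_apply hJ, aeval_T_apply_eq_zero hJ _ (i + 1) _ (by omega),
      aeval_T_apply_eq_zero hJ _ i _ (by omega), aeval_T_apply_eq_zero hJ n i _ (by omega),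
      show i - ((n + 1 + 1 : ℕ) : ℤ) = i - 1 - (n + 1 : ℕ) by push_cast; ring, ih,
      Finset.prod_range_succ _ (n + 1),
      show i - 1 - ((n + 1 : ℕ) : ℤ) + 1 + (n + 1 : ℕ) = i by ring]
    simp [mul_comm (p i)]

/-- Away from the perturbation `T_n(J)` acts as for the free Jacobi matrix. -/
lemma aeval_T_apply_of_free
    (hJ : ∀ k : ℤ, J (ez k) = p k • ez (k - 1) + q k • ez k + p (k + 1) • ez (k + 1))
    (n : ℕ) (i j : ℤ) (h : ∀ k, i - n ≤ k → k ≤ i + n → p k = 1 ∧ q k = 0) :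
    aeval J (T n) (ez i) j = (if j = i + n then 1 else 0) + (if j = i - n then 1 else 0) := by
  induction n using Nat.twoStepInduction generalizing i with
  | zero => rw [aeval_T_zero_apply]; split_ifs <;> first | omega | norm_num
  | one =>
    rw [aeval_T_one_apply hJ, (h i (by omega) (by omega)).1, (h i (by omega) (by omega)).2,
      (h (i + 1) (by omega) (by omega)).1]
    split_ifs <;> first | omega | norm_num
  | more n ih₀ ih₁ =>
    rw [aeval_T_succ_succ_apply hJ, (h i (by omega) (by omega)).1,
      (h i (by omega) (by omega)).2, (h (i + 1) (by omega) (by omega)).1,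
      ih₀ i fun k _ _ => h k (by omega) (by omega),
      ih₁ (i - 1) fun k _ _ => h k (by omega) (by omega),
      ih₁ (i + 1) fun k _ _ => h k (by omega) (by omega)]
    have e₁ : i - 1 + ((n + 1 : ℕ) : ℤ) = i + n := by push_cast; ring
    have e₂ : i + 1 - ((n + 1 : ℕ) : ℤ) = i - n := by push_cast; ring
    have e₃ : i + 1 + ((n + 1 : ℕ) : ℤ) = i + (n + 2 : ℕ) := by push_cast; ring
    have e₄ : i - 1 - ((n + 1 : ℕ) : ℤ) = i - (n + 2 : ℕ) := by push_cast; ring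
    rw [e₁, e₂, e₃, e₄]
    ring

lemma norm_sq_aeval_T
    (hJ : ∀ k : ℤ, J (ez k) = p k • ez (k - 1) + q k • ez k + p (k + 1) • ez (k + 1))
    (n : ℕ) (i : ℤ) :
    ‖aeval J (T (n + 1)) (ez i)‖ ^ 2
      = (∑ j ∈ Finset.Icc (i - n) (i + n), aeval J (T (n + 1)) (ez i) j ^ 2)
        + (∏ k ∈ Finset.range (n + 1), p (i + 1 + k)) ^ 2
        + (∏ k ∈ Finset.range (n + 1), p (i - (n + 1 : ℕ) + 1 + k)) ^ 2 := by
  rw [← aeval_T_apply_add hJ, ← aeval_T_apply_sub hJ, norm_sq_eq_sum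
    (s := insert (i - (n + 1 : ℕ)) (insert (i + (n + 1 : ℕ)) (Finset.Icc (i - n) (i + n)))),
    Finset.sum_insert, Finset.sum_insert]
  · ring
  · simp
  · simp only [Finset.mem_insert, Finset.mem_Icc]
    omega
  · intro j hj
    simp only [Finset.mem_insert, Finset.mem_Icc] at hj
    exact aeval_T_apply_eq_zero hJ _ _ _ (by omega)

end Jacobi

lemma finite_setOf_exists_near {B : Set ℤ} (hB : B.Finite) (n : ℤ) :
    {i : ℤ | ∃ k ∈ B, i - n ≤ k ∧ k ≤ i + n}.Finite := by
  refine (hB.biUnion fun b _ => Set.finite_Icc (b - n) (b + n)).subset ?_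
  rintro i ⟨k, hk, h₁, h₂⟩
  simp only [Set.mem_iUnion, Set.mem_Icc]
  exact ⟨k, hk, by omega, by omega⟩

lemma prod_Icc_eq_prod_range {M : Type*} [CommMonoid M] (f : ℤ → M) (i : ℤ) (l : ℕ) :
    ∏ k ∈ Finset.Icc (i + 1) (i + l), f k = ∏ k ∈ Finset.range l, f (i + 1 + k) := by
  symm
  refine Finset.prod_bij (fun k _ => i + 1 + (k : ℤ)) ?_ ?_ ?_ ?_
  · intro k hk
    simp only [Finset.mem_range, Finset.mem_Icc] at *
    omega
  · intro a _ b _ h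
    omega
  · intro b hb
    simp only [Finset.mem_range, Finset.mem_Icc] at *
    exact ⟨(b - (i + 1)).toNat, by omega, by omega⟩
  · simp

/-- The trace identity
`(1/2l) Σ_i (‖T_l(J)e_i‖² - 2) - Σ_i log p_i²
  = (1/l) [ (1/2) Σ_i Σ_{|j-i| ≤ l-1} ⟨T_l(J)e_i, e_j⟩² + Σ_i ((t_l)_i² - 1 - log (t_l)_i²) ]`
for a finite rank perturbation of the free two-sided Jacobi matrix, where
`(t_l)_i = p_{i+1}⋯p_{i+l}`. -/
theorem stmt_15
    (p q : ℤ → ℝ) (hp : ∀ k, 0 < p k)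
    (hfp : {k : ℤ | p k ≠ 1}.Finite) (hfq : {k : ℤ | q k ≠ 0}.Finite)
    (J : HZ →L[ℝ] HZ)
    (hJ : ∀ k : ℤ, J (ez k) = p k • ez (k - 1) + q k • ez k + p (k + 1) • ez (k + 1))
    (l : ℕ) (hl : 1 ≤ l) :
    (1 / (2 * (l : ℝ))) * (∑' i : ℤ, (‖aeval J (T l) (ez i)‖ ^ 2 - 2))
      - ∑' i : ℤ, Real.log (p i ^ 2)
    = (1 / (l : ℝ)) *
        ((1 / 2) * (∑' i : ℤ, ∑ j ∈ Finset.Icc (i - ((l : ℤ) - 1)) (i + ((l : ℤ) - 1)),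
            ⟪aeval J (T l) (ez i), ez j⟫ ^ 2)
          + ∑' i : ℤ,
              ((∏ k ∈ Finset.Icc (i + 1) (i + l), p k) ^ 2 - 1
                - Real.log ((∏ k ∈ Finset.Icc (i + 1) (i + l), p k) ^ 2))) := by
  obtain ⟨n, rfl⟩ : ∃ n, l = n + 1 := ⟨l - 1, by omega⟩
  have hl0 : ((n + 1 : ℕ) : ℝ) ≠ 0 := by positivity
  have hcast : ((n + 1 : ℕ) : ℤ) - 1 = n := by push_cast; ring
  simp only [inner_ez, prod_Icc_eq_prod_range, norm_sq_aeval_T hJ, hcast]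
  set D : ℤ → ℝ := fun i =>
    ∑ j ∈ Finset.Icc (i - n) (i + n), aeval J (T (n + 1)) (ez i) j ^ 2 with hD
  set t : ℤ → ℝ := fun i => ∏ k ∈ Finset.range (n + 1), p (i + 1 + k) with ht
  have hfar : ∀ f : ℤ → ℝ, (∀ i : ℤ, (∀ k : ℤ, i - (n + 1 : ℕ) ≤ k → k ≤ i + (n + 1 : ℕ) →
      p k = 1 ∧ q k = 0) → f i = 0) → Summable f := by
    intro f hf
    refine summable_of_hasFiniteSupport
      ((finite_setOf_exists_near (hfp.union hfq) (n + 1 : ℕ)).subset fun i hi => ?_)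
    by_contra hcon
    refine hi (hf i fun k h₁ h₂ => ?_)
    by_contra hk
    refine hcon ⟨k, ?_, h₁, h₂⟩
    simp only [Set.mem_union, Set.mem_ofPred_eq]
    tauto
  have htfar : ∀ i : ℤ, (∀ k : ℤ, i - (n + 1 : ℕ) ≤ k → k ≤ i + (n + 1 : ℕ) →
      p k = 1 ∧ q k = 0) → t i = 1 := by
    intro i hi
    refine Finset.prod_eq_one fun k hk => (hi _ ?_ ?_).1 <;>
      rw [Finset.mem_range] at hk <;> omega
  have hsD : Summable D := hfar _ fun i hi => Finset.sum_eq_zero fun j hj => by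
    rw [Finset.mem_Icc] at hj
    rw [aeval_T_apply_of_free hJ _ i j hi, if_neg (by omega), if_neg (by omega)]
    simp
  have hst : Summable fun i => t i ^ 2 - 1 := hfar _ fun i hi => by simp [htfar i hi]
  have hslog : Summable fun i => Real.log (t i ^ 2) := hfar _ fun i hi => by simp [htfar i hi]
  have hsp : Summable fun i => Real.log (p i ^ 2) := hfar _ fun i hi => by
    simp [(hi i (by omega) (by omega)).1]
  have hst' : Summable fun i : ℤ => t (i - (n + 1 : ℕ)) ^ 2 - 1 :=
    hst.comp_injective (sub_left_injective (b := ((n + 1 : ℕ) : ℤ)))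
  have hshift : ∑' i : ℤ, (t (i - (n + 1 : ℕ)) ^ 2 - 1) = ∑' i, (t i ^ 2 - 1) :=
    (Equiv.subRight ((n + 1 : ℕ) : ℤ)).tsum_eq fun i => t i ^ 2 - 1
  have hlog : ∑' i, Real.log (t i ^ 2) = (n + 1 : ℕ) * ∑' i, Real.log (p i ^ 2) := by
    have h : ∀ i, Real.log (t i ^ 2)
        = ∑ k ∈ Finset.range (n + 1), Real.log (p (i + 1 + k) ^ 2) := fun i => by
      rw [ht, ← Finset.prod_pow, Real.log_prod fun k _ => (pow_pos (hp _) 2).ne']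
    have hs (k : ℕ) : ∑' i : ℤ, Real.log (p (i + 1 + k) ^ 2) = ∑' i, Real.log (p i ^ 2) := by
      simp only [add_assoc]
      exact (Equiv.addRight (1 + (k : ℤ))).tsum_eq fun i => Real.log (p i ^ 2)
    simp only [h]
    rw [Summable.tsum_finsetSum fun k _ => ?_]
    · simp only [hs, Finset.sum_const, Finset.card_range, nsmul_eq_mul]
    · simp only [add_assoc]
      exact hsp.comp_injective (add_left_injective (1 + (k : ℤ)))
  have hnorm : ∑' i : ℤ, (D i + t i ^ 2 + t (i - (n + 1 : ℕ)) ^ 2 - 2)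
      = ∑' i, D i + 2 * ∑' i, (t i ^ 2 - 1) := by
    rw [two_mul]
    nth_rewrite 2 [← hshift]
    rw [← add_assoc, ← hsD.tsum_add hst, ← (hsD.add hst).tsum_add hst']
    exact tsum_congr fun i => by ring
  rw [hnorm, hst.tsum_sub hslog, hlog]
  field_simp
  ring

end
end

section
/- There exist continuous functions g : K^N → ℝ with g ≥ 0 everywhere and γ : K^{N−1} → ℝ such that for every one-sided Jacobi matrix J whose coefficients satisfy p_k ∈ [ε, M] for all k ≥ 1 and q_k ∈ [−M, M] for all k ≥ 0, one has h_A(J) = g(v₁, …, v_N) + γ(v₂, …, v_N) − γ(v₁, …, v_{N−1}), where v_j := (p_j, q_{j−1}) ∈ K for 1 ≤ j ≤ N. -/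
open Polynomial
open scoped ENNReal RealInnerProductSpace Real

noncomputable section

/-- The real Hilbert space `ℓ²(ℕ)`. -/
abbrev H : Type := lp (fun _ : ℕ => ℝ) 2

/-- The standard orthonormal basis of `ℓ²(ℕ)`. -/
def e (k : ℕ) : H := lp.single 2 k 1

/-- If window sums of `h` along sequences in `K` are bounded below up to an arbitrarily small
linear error, then they are bounded below. -/
theorem exists_le_windowSum_of_linear_error {X : Type*} {K : Set X} (n : ℕ)
    (h : (Fin (n + 1) → X) → ℝ) (B : ℝ)
    (hB : ∀ v : Fin (n + 1) → X, (∀ i, v i ∈ K) → h v ≤ B)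
    (hlin : ∀ η > 0, ∃ C : ℝ, ∀ s : ℕ → X, (∀ i, s i ∈ K) → ∀ L : ℕ,
      -(η * L) - C ≤ ∑ i ∈ Finset.range L, h (fun j => s (i + j))) :
    ∃ C : ℝ, ∀ s : ℕ → X, (∀ i, s i ∈ K) → ∀ L : ℕ,
      C ≤ ∑ i ∈ Finset.range L, h (fun j => s (i + j)) := by
  refine ⟨-(n * B), fun s hs L => ?_⟩
  set P := L + n with hP
  set t : ℕ → X := fun i => s (i % P) with ht
  have htK : ∀ i, t i ∈ K := fun i => hs _
  have hper : ∀ R : ℕ, ∑ i ∈ Finset.range (R * P), h (fun j => t (i + j))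
      = R * ∑ i ∈ Finset.range P, h (fun j => t (i + j)) := by
    intro R
    induction R with
    | zero => simp
    | succ R ih =>
      rw [add_mul, one_mul, Finset.sum_range_add, ih]
      have : ∀ i, (fun j : Fin (n + 1) => t (R * P + i + j))
          = fun j : Fin (n + 1) => t (i + j) := by
        intro i
        ext1 j
        simp only [ht]
        rw [show R * P + i + (j : ℕ) = (i + j) + P * R by ring, Nat.add_mul_mod_self_left]
      simp only [this]
      push_cast
      ring
  have hle : ∑ i ∈ Finset.range P, h (fun j => t (i + j))
      ≤ ∑ i ∈ Finset.range L, h (fun j => s (i + j)) + n * B := by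
    rw [hP, Finset.sum_range_add]
    refine add_le_add (Finset.sum_le_sum fun i hi => le_of_eq ?_) ?_
    · congr 1
      ext1 j
      have := j.2
      have := Finset.mem_range.1 hi
      simp only [ht]
      rw [Nat.mod_eq_of_lt (by omega)]
    · calc _ ≤ ∑ i ∈ Finset.range n, B := Finset.sum_le_sum fun i _ => hB _ fun _ => htK _
        _ = n * B := by simp
  set T := ∑ i ∈ Finset.range P, h (fun j => t (i + j)) with hT
  have key : ∀ η > 0, -(η * P) ≤ T := by
    intro η hη
    obtain ⟨C, hC⟩ := hlin η hη
    by_contra! hlt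
    obtain ⟨R, hR⟩ := exists_nat_gt (C / (-(η * P) - T))
    rw [div_lt_iff₀ (by linarith)] at hR
    have := hC t htK (R * P)
    rw [hper] at this
    push_cast at this
    nlinarith
  have hT0 : 0 ≤ T := by
    by_contra! hlt
    have h1 := key (-T / (P + 1) / 2)
      (by apply div_pos (div_pos (by linarith) (by positivity)); norm_num)
    have h2 : -T / (P + 1) / 2 * P ≤ -T / 2 := by
      rw [div_div, div_mul_eq_mul_div, div_le_div_iff₀ (by positivity) (by norm_num)]
      nlinarith [Nat.cast_nonneg (α := ℝ) P]
    linarith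
  linarith

/-- The infimum of the forward window sums issuing from a given word is a continuous subsolution
of the cohomological equation for `h`. -/
theorem exists_continuousOn_subsolution {X : Type*} [PseudoMetricSpace X] {K : Set X}
    (hK : IsCompact K) (n : ℕ) (h : (Fin (n + 1) → X) → ℝ)
    (hc : ContinuousOn h {v | ∀ i, v i ∈ K})
    (hbdd : ∃ C : ℝ, ∀ s : ℕ → X, (∀ i, s i ∈ K) → ∀ L : ℕ,
      C ≤ ∑ i ∈ Finset.range L, h (fun j => s (i + j))) :
    ∃ V : (Fin n → X) → ℝ, ContinuousOn V {v | ∀ i, v i ∈ K} ∧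
      ∀ v : Fin (n + 1) → X, (∀ i, v i ∈ K) →
        V (fun j => v j.castSucc) ≤ h v + V (fun j => v j.succ) := by
  classical
  obtain ⟨C, hC⟩ := hbdd
  rcases K.eq_empty_or_nonempty with rfl | ⟨x₀, hx₀⟩
  · exact ⟨fun _ => 0, continuousOn_const, fun v hv => (hv 0).elim⟩
  set S := {t : ℕ → X // ∀ i, t i ∈ K} with hS
  have : Nonempty S := ⟨⟨fun _ => x₀, fun _ => hx₀⟩⟩
  set glue : (Fin n → X) → (ℕ → X) → ℕ → X :=
    fun w t i => if hi : i < n then w ⟨i, hi⟩ else t i with hglue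
  have glueK : ∀ w t, (∀ i, w i ∈ K) → (∀ i, t i ∈ K) → ∀ i, glue w t i ∈ K := by
    intro w t hw ht i
    simp only [hglue]
    split_ifs
    exacts [hw _, ht _]
  set F : (ℕ → X) → ℕ → ℝ := fun s L => ∑ i ∈ Finset.range L, h (fun j => s (i + j)) with hF
  set V : (Fin n → X) → ℝ := fun w => ⨅ x : S × ℕ, F (glue w x.1.1) x.2 with hV
  have bdd : ∀ w : Fin n → X, (∀ i, w i ∈ K) →
      BddBelow (Set.range fun x : S × ℕ => F (glue w x.1.1) x.2) := by
    intro w hw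
    refine ⟨C, ?_⟩
    rintro _ ⟨x, rfl⟩
    exact hC _ (glueK w _ hw x.1.2) _
  have hKn : ∀ k : ℕ, IsCompact {v : Fin k → X | ∀ i, v i ∈ K} := by
    intro k
    have := isCompact_univ_pi (fun _ : Fin k => hK)
    convert this using 1
    ext v
    simp
  have hVc : ContinuousOn V {v | ∀ i, v i ∈ K} := by
    have huc := (hKn (n + 1)).uniformContinuousOn_of_continuous hc
    rw [Metric.uniformContinuousOn_iff] at huc
    rw [Metric.continuousOn_iff]
    intro w hw η hη
    obtain ⟨d, hd, hd'⟩ := huc (η / (2 * (n + 1))) (by positivity)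
    refine ⟨d, hd, fun w' hw' hdist => ?_⟩
    have main : ∀ w₁ w₂ : Fin n → X, (∀ i, w₁ i ∈ K) → (∀ i, w₂ i ∈ K) → dist w₁ w₂ < d →
        V w₁ ≤ V w₂ + η / 2 := by
      intro w₁ w₂ h₁ h₂ h₁₂
      have step : ∀ x : S × ℕ, F (glue w₁ x.1.1) x.2 ≤ F (glue w₂ x.1.1) x.2 + η / 2 := by
        intro x
        have hpt : ∀ i, dist (glue w₁ x.1.1 i) (glue w₂ x.1.1 i) < d := by
          intro i
          simp only [hglue]
          split_ifs
          · exact (dist_le_pi_dist w₁ w₂ _).trans_lt h₁₂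
          · simpa using hd
        have hwin : ∀ i, h (fun j => glue w₁ x.1.1 (i + j)) ≤ h (fun j => glue w₂ x.1.1 (i + j))
            + if i < n then η / (2 * (n + 1)) else 0 := by
          intro i
          split_ifs with hi
          · have := hd' (fun j => glue w₁ x.1.1 (i + j)) (fun j => glueK _ _ h₁ x.1.2 _)
              (fun j => glue w₂ x.1.1 (i + j)) (fun j => glueK _ _ h₂ x.1.2 _)
              ((dist_pi_lt_iff hd).2 fun j => hpt _)
            rw [Real.dist_eq] at this
            linarith [(abs_lt.1 this).2]
          · have : (fun j : Fin (n + 1) => glue w₁ x.1.1 (i + j))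
                = fun j : Fin (n + 1) => glue w₂ x.1.1 (i + j) := by
              ext1 j
              simp only [hglue]
              rw [dif_neg (by omega), dif_neg (by omega)]
            rw [this]
            simp
        calc F (glue w₁ x.1.1) x.2 ≤ ∑ i ∈ Finset.range x.2, (h (fun j => glue w₂ x.1.1 (i + j))
                + if i < n then η / (2 * (n + 1)) else 0) := Finset.sum_le_sum fun i _ => hwin i
          _ = F (glue w₂ x.1.1) x.2
              + ∑ i ∈ Finset.range x.2, if i < n then η / (2 * (n + 1)) else 0 :=
            Finset.sum_add_distrib
          _ ≤ F (glue w₂ x.1.1) x.2 + η / 2 := by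
            gcongr
            rw [← Finset.sum_filter]
            calc _ ≤ ∑ i ∈ Finset.range n, η / (2 * ((n : ℝ) + 1)) := by
                  refine Finset.sum_le_sum_of_subset_of_nonneg ?_ fun _ _ _ => by positivity
                  intro i
                  simp
              _ = n * (η / (2 * ((n : ℝ) + 1))) := by simp
              _ ≤ η / 2 := by
                rw [mul_div_assoc', div_le_div_iff₀ (by positivity) (by norm_num)]
                nlinarith
      have : V w₁ - η / 2 ≤ V w₂ := le_ciInf fun x => by
        have := (ciInf_le (bdd w₁ h₁) x).trans (step x)
        simp only [hV]
        linarith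
      linarith
    have h1 := main w' w hw' hw hdist
    have h2 := main w w' hw hw' (by rwa [dist_comm])
    rw [Real.dist_eq, abs_lt]
    constructor <;> linarith
  refine ⟨V, hVc, fun v hv => ?_⟩
  rw [← sub_le_iff_le_add']
  refine le_ciInf fun x => ?_
  set s := glue (fun j => v j.succ) x.1.1 with hs
  have hsK : ∀ i, s i ∈ K := glueK _ _ (fun _ => hv _) x.1.2
  set u : ℕ → X := fun i => Nat.casesOn i (v 0) s with hu
  have huK : ∀ i, u i ∈ K := by
    rintro (_ | i)
    exacts [hv 0, hsK i]
  have huv : ∀ j : Fin (n + 1), u j = v j := by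
    intro j
    refine Fin.cases rfl (fun k => ?_) j
    simp only [hu, hs, hglue, Fin.val_succ, Fin.is_lt, dif_pos]
  have hgl : glue (fun j => v j.castSucc) u = u := by
    ext1 i
    simp only [hglue]
    split_ifs with hi
    · exact (huv ⟨i, by omega⟩).symm
    · rfl
  have := ciInf_le (bdd (fun j => v j.castSucc) fun _ => hv _)
    ((⟨u, huK⟩, x.2 + 1) : S × ℕ)
  simp only [hgl] at this
  have hsum : F u (x.2 + 1) = F s x.2 + h v := by
    simp only [hF]
    rw [Finset.sum_range_succ']
    congr 1
    · refine Finset.sum_congr rfl fun i _ => ?_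
      congr 1
      ext1 j
      rw [show i + 1 + (j : ℕ) = (i + j) + 1 by ring]
    · congr 1
      ext1 j
      rw [zero_add, huv]
  rw [hsum] at this
  simp only [hV]
  linarith

theorem exists_nonneg_add_coboundary {X : Type*} [PseudoMetricSpace X] {K : Set X}
    (hK : IsCompact K) (n : ℕ) (h : (Fin (n + 1) → X) → ℝ)
    (hc : ContinuousOn h {v | ∀ i, v i ∈ K})
    (hbdd : ∃ C : ℝ, ∀ s : ℕ → X, (∀ i, s i ∈ K) → ∀ L : ℕ,
      C ≤ ∑ i ∈ Finset.range L, h (fun j => s (i + j))) :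
    ∃ g : (Fin (n + 1) → X) → ℝ, ∃ γ : (Fin n → X) → ℝ,
      ContinuousOn g {v | ∀ i, v i ∈ K} ∧ ContinuousOn γ {v | ∀ i, v i ∈ K} ∧
      (∀ v : Fin (n + 1) → X, (∀ i, v i ∈ K) → 0 ≤ g v) ∧
      ∀ v : Fin (n + 1) → X,
        h v = g v + γ (fun j => v j.succ) - γ (fun j => v j.castSucc) := by
  obtain ⟨V, hVc, hV⟩ := exists_continuousOn_subsolution hK n h hc hbdd
  have hs : ContinuousOn (fun v : Fin (n + 1) → X => V fun j => v j.succ) {v | ∀ i, v i ∈ K} :=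
    hVc.comp (f := fun (v : Fin (n + 1) → X) (j : Fin n) => v j.succ)
      (Continuous.continuousOn (by fun_prop)) fun v hv i => hv _
  have hcs : ContinuousOn (fun v : Fin (n + 1) → X => V fun j => v j.castSucc)
      {v | ∀ i, v i ∈ K} :=
    hVc.comp (f := fun (v : Fin (n + 1) → X) (j : Fin n) => v j.castSucc)
      (Continuous.continuousOn (by fun_prop)) fun v hv i => hv _
  exact ⟨fun v => h v + V (fun j => v j.succ) - V (fun j => v j.castSucc), fun w => -V w,
    (hc.add hs).sub hcs, hVc.neg, fun v hv => by linarith [hV v hv], fun v => by ring⟩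

theorem S_two_mul_cos_mul_sin_sq (n : ℕ) (θ : ℝ) :
    (Chebyshev.S ℝ n).eval (2 * Real.cos θ) * (4 * Real.sin θ ^ 2)
      = 2 * Real.cos (n * θ) - 2 * Real.cos ((n + 2 : ℕ) * θ) := by
  have h := Chebyshev.S_two_mul_real_cos θ n
  push_cast at h ⊢
  rw [show (Chebyshev.S ℝ n).eval (2 * Real.cos θ) * (4 * Real.sin θ ^ 2)
    = 4 * ((Chebyshev.S ℝ n).eval (2 * Real.cos θ) * Real.sin θ) * Real.sin θ by ring, h]
  have h1 : (n : ℝ) * θ = (n + 1) * θ - θ := by ring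
  have h2 : ((n : ℝ) + 2) * θ = (n + 1) * θ + θ := by ring
  rw [h1, h2, Real.cos_sub, Real.cos_add]
  ring

theorem integral_cos_nat_mul (c : ℝ) (n : ℕ) (hn : n ≠ 0) (hc : Real.sin (n * c) = 0) :
    ∫ θ in (0 : ℝ)..c, Real.cos (n * θ) = 0 := by
  rw [intervalIntegral.integral_comp_mul_left (fun x => Real.cos x) (by exact_mod_cast hn)]
  simp [hc]

theorem integral_mul_sqrt_four_sub_sq {f : ℝ → ℝ} (hf : Continuous f) :
    ∫ x in (-2 : ℝ)..2, f x * √(4 - x ^ 2)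
      = ∫ θ in (0 : ℝ)..π, f (2 * Real.cos θ) * (4 * Real.sin θ ^ 2) := by
  have h := intervalIntegral.integral_comp_mul_deriv (a := 0) (b := π)
    (f := fun θ => 2 * Real.cos θ) (f' := fun θ => 2 * -Real.sin θ)
    (g := fun x => f x * √(4 - x ^ 2))
    (fun θ _ => (Real.hasDerivAt_cos θ).const_mul 2) (by fun_prop) (by fun_prop)
  simp only [Real.cos_zero, Real.cos_pi, mul_one, mul_neg] at h
  rw [intervalIntegral.integral_symm, ← h, ← intervalIntegral.integral_neg]
  refine intervalIntegral.integral_congr fun θ hθ => ?_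
  rw [Set.uIcc_of_le Real.pi_pos.le] at hθ
  have hs := Real.sin_nonneg_of_mem_Icc hθ
  have : (4 - (2 * Real.cos θ) ^ 2) = (2 * Real.sin θ) ^ 2 := by
    nlinarith [Real.sin_sq_add_cos_sq θ]
  simp only [Function.comp, this, Real.sqrt_sq (mul_nonneg zero_le_two hs)]
  ring

theorem integral_S_mul_sqrt (n : ℕ) :
    ∫ x in (-2 : ℝ)..2, (Chebyshev.S ℝ n).eval x * √(4 - x ^ 2) = if n = 0 then 2 * π else 0 := by
  rw [integral_mul_sqrt_four_sub_sq (Polynomial.continuous _)]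
  simp only [S_two_mul_cos_mul_sin_sq]
  rw [intervalIntegral.integral_sub (Continuous.intervalIntegrable (by fun_prop) _ _)
    (Continuous.intervalIntegrable (by fun_prop) _ _), intervalIntegral.integral_const_mul,
    intervalIntegral.integral_const_mul,
    integral_cos_nat_mul π (n + 2) (by omega) (Real.sin_nat_mul_pi _)]
  split_ifs with h
  · subst h
    simp
  · rw [integral_cos_nat_mul π n h (Real.sin_nat_mul_pi _)]
    simp

/-- The secondary polynomial of `A` with respect to the semicircle weight, as a function. -/
def secondary (A : ℝ[X]) (z : ℝ) : ℝ :=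
  (1 / π) * ∫ x in (-2 : ℝ)..2, ((A.eval x - A.eval z) / (x - z)) * √(4 - x ^ 2)

theorem intervalIntegrable_dividedDifference (A : ℝ[X]) (z : ℝ) :
    IntervalIntegrable (fun x => ((A.eval x - A.eval z) / (x - z)) * √(4 - x ^ 2))
      MeasureTheory.volume (-2) 2 := by
  have h : Continuous fun x => (A /ₘ (X - C z)).eval x * √(4 - x ^ 2) := by fun_prop
  refine (h.intervalIntegrable (-2) 2).congr_ae ?_
  refine MeasureTheory.ae_restrict_of_ae ?_
  filter_upwards [MeasureTheory.Measure.ae_ne MeasureTheory.volume z] with x hx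
  have h1 := congrArg (Polynomial.eval x) (X_sub_C_mul_divByMonic_eq_sub_modByMonic A z)
  simp only [modByMonic_X_sub_C_eq_C_eval, eval_mul, eval_sub, eval_X, eval_C] at h1
  rw [← h1, mul_div_cancel_left₀ _ (sub_ne_zero.2 hx)]

theorem secondary_sum {ι : Type*} (s : Finset ι) (α : ι → ℝ) (P : ι → ℝ[X]) (z : ℝ) :
    secondary (∑ i ∈ s, C (α i) * P i) z = ∑ i ∈ s, α i * secondary (P i) z := by
  unfold secondary
  simp only [mul_left_comm (α _) (1 / π), ← intervalIntegral.integral_const_mul (α _)]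
  rw [← Finset.mul_sum, ← intervalIntegral.integral_finsetSum
    fun i _ => (intervalIntegrable_dividedDifference (P i) z).const_mul _]
  congr 2
  ext x
  simp only [eval_finsetSum, eval_mul, eval_C, ← Finset.sum_sub_distrib, Finset.sum_div,
    Finset.sum_mul]
  refine Finset.sum_congr rfl fun i _ => ?_
  ring

theorem secondary_S_add_two (n : ℕ) (z : ℝ) :
    secondary (Chebyshev.S ℝ (n + 2 : ℕ)) z
      = z * secondary (Chebyshev.S ℝ (n + 1 : ℕ)) z - secondary (Chebyshev.S ℝ n) z := by
  have h1 := intervalIntegrable_dividedDifference (Chebyshev.S ℝ (n + 1 : ℕ)) z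
  have h0 := intervalIntegrable_dividedDifference (Chebyshev.S ℝ n) z
  have hS : IntervalIntegrable (fun x => (Chebyshev.S ℝ (n + 1 : ℕ)).eval x * √(4 - x ^ 2))
      MeasureTheory.volume (-2) 2 := Continuous.intervalIntegrable (by fun_prop) _ _
  have hS0 := integral_S_mul_sqrt (n + 1)
  rw [if_neg (by omega)] at hS0
  unfold secondary
  rw [mul_left_comm, ← mul_sub, ← intervalIntegral.integral_const_mul z,
    ← intervalIntegral.integral_sub (h1.const_mul z) h0,
    ← add_zero (∫ x in (-2 : ℝ)..2, _ - _), ← hS0,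
    ← intervalIntegral.integral_add ((h1.const_mul z).sub h0) hS]
  congr 1
  refine intervalIntegral.integral_congr_ae ?_
  filter_upwards [MeasureTheory.Measure.ae_ne MeasureTheory.volume z] with x hx _
  have hx' := sub_ne_zero.2 hx
  have hrec := Chebyshev.S_add_two ℝ n
  push_cast
  rw [hrec]
  simp only [eval_sub, eval_mul, eval_X]
  field_simp
  ring

theorem secondary_S : ∀ (n : ℕ) (z : ℝ),
    secondary (Chebyshev.S ℝ n) z = 2 * (Chebyshev.S ℝ ((n : ℤ) - 1)).eval z
  | 0, z => by simp [secondary]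
  | 1, z => by
    have h0 := integral_S_mul_sqrt 0
    have : secondary (Chebyshev.S ℝ (1 : ℕ)) z
        = (1 / π) * ∫ x in (-2 : ℝ)..2, (Chebyshev.S ℝ (0 : ℕ)).eval x * √(4 - x ^ 2) := by
      unfold secondary
      congr 1
      refine intervalIntegral.integral_congr_ae ?_
      filter_upwards [MeasureTheory.Measure.ae_ne MeasureTheory.volume z] with x hx _
      simp [div_self (sub_ne_zero.2 hx)]
    rw [this, h0]
    simp
    field_simp
  | n + 2, z => by
    rw [secondary_S_add_two, secondary_S (n + 1), secondary_S n]
    have := Chebyshev.S_add_two ℝ ((n : ℤ) - 1)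
    rw [show (n : ℤ) - 1 + 2 = n + 1 by ring, show (n : ℤ) - 1 + 1 = n by ring] at this
    push_cast
    rw [show (n : ℤ) + 2 - 1 = n + 1 by ring, show (n : ℤ) + 1 - 1 = n by ring, this]
    simp
    ring

theorem X_mul_S_sub_two_mul_S (n : ℤ) :
    (X : ℝ[X]) * Chebyshev.S ℝ n - 2 * Chebyshev.S ℝ (n - 1) = Chebyshev.C ℝ (n + 1) := by
  have h1 := Chebyshev.C_eq_S_sub_X_mul_S ℝ (n + 1)
  have h2 := Chebyshev.S_add_one ℝ n
  rw [add_sub_cancel_right] at h1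
  rw [h1, h2]
  ring

theorem natDegree_S_monic : ∀ n : ℕ,
    (Chebyshev.S ℝ n).natDegree = n ∧ (Chebyshev.S ℝ n).Monic
  | 0 => by simp
  | 1 => by simp [monic_X]
  | n + 2 => by
    obtain ⟨d1, m1⟩ := natDegree_S_monic (n + 1)
    obtain ⟨d0, m0⟩ := natDegree_S_monic n
    have hm : (X * Chebyshev.S ℝ (n + 1 : ℕ)).Monic := monic_X.mul m1
    have hd : (X * Chebyshev.S ℝ (n + 1 : ℕ)).natDegree = n + 2 := by
      rw [monic_X.natDegree_mul m1, d1, natDegree_X]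
      ring
    have hlt : (Chebyshev.S ℝ n).degree < (X * Chebyshev.S ℝ (n + 1 : ℕ)).degree := by
      rw [degree_eq_natDegree m0.ne_zero, degree_eq_natDegree hm.ne_zero, hd, d0]
      exact_mod_cast (by omega : n < n + 2)
    have hrec := Chebyshev.S_add_two ℝ n
    push_cast at hrec hm hd hlt ⊢
    rw [hrec]
    exact ⟨by
      rw [natDegree_sub_eq_left_of_natDegree_lt (natDegree_lt_natDegree m0.ne_zero hlt), hd],
      hm.sub_of_left hlt⟩

/-- Every real polynomial of degree at most `m` is a combination of `S₀, …, S_m`. -/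
theorem exists_eq_sum_S (m : ℕ) (A : ℝ[X]) (hA : A.natDegree ≤ m) :
    ∃ α : ℕ → ℝ, A = ∑ n ∈ Finset.range (m + 1), C (α n) * Chebyshev.S ℝ n := by
  induction m generalizing A with
  | zero =>
    refine ⟨fun _ => A.coeff 0, ?_⟩
    simpa using eq_C_of_natDegree_le_zero hA
  | succ m ih =>
    obtain ⟨hd, hm⟩ := natDegree_S_monic (m + 1)
    obtain ⟨α, hα⟩ := ih (A - C (A.coeff (m + 1)) * Chebyshev.S ℝ (m + 1 : ℕ)) (by
      rw [natDegree_le_iff_coeff_eq_zero]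
      intro N hN
      rw [coeff_sub, coeff_C_mul]
      rcases (Nat.succ_le_of_lt hN).eq_or_lt with h | h
      · rw [← h]
        have : (Chebyshev.S ℝ (m + 1 : ℕ)).coeff (m + 1) = 1 := by
          conv_lhs => rw [← hd]
          rw [hd]
          have := hm.coeff_natDegree
          rwa [hd] at this
        simp only [Nat.succ_eq_add_one, this]
        ring
      · have h' : m + 1 < N := h
        rw [coeff_eq_zero_of_natDegree_lt (by omega), coeff_eq_zero_of_natDegree_lt
          (p := Chebyshev.S ℝ (m + 1 : ℕ)) (by rw [hd]; exact h')]
        ring)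
    refine ⟨fun n => if n = m + 1 then A.coeff (m + 1) else α n, ?_⟩
    simp only [Finset.sum_range_succ _ (m + 1), if_true]
    rw [← sub_eq_iff_eq_add, hα]
    refine Finset.sum_congr rfl fun n hn => ?_
    rw [if_neg (by have := Finset.mem_range.1 hn; omega)]

theorem derivative_chebyshev_C (n : ℤ) :
    derivative (Chebyshev.C ℝ n) = (n : ℝ[X]) * Chebyshev.S ℝ (n - 1) := by
  have h := congrArg derivative (Chebyshev.C_comp_two_mul_X ℝ n)
  have h2 : derivative ((2 : ℝ[X]) * X) = 2 := by simp
  have h3 : derivative (2 * Chebyshev.T ℝ n) = 2 * ((n : ℝ[X]) * Chebyshev.U ℝ (n - 1)) := by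
    rw [derivative_mul, Chebyshev.T_derivative_eq_U]
    simp
  rw [derivative_comp, h2, h3, ← Chebyshev.S_comp_two_mul_X] at h
  have h4 := mul_left_cancel₀ two_ne_zero h
  have h5 := congrArg (fun p : ℝ[X] => p.comp (C (1 / 2) * X)) h4
  have h6 : ((2 : ℝ[X]) * X).comp (C (1 / 2) * X) = X := by
    rw [show (2 : ℝ[X]) = C 2 from rfl, mul_comp, X_comp, C_comp, ← mul_assoc, ← C_mul]
    norm_num
  simp only [mul_comp, comp_assoc, h6, comp_X, intCast_comp] at h5
  exact h5

/-- The polynomial `∑ αₙ (C_{n+2} / (n+2) - C_n / n)`, where the summand `C₀ / 0` is zero. -/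
def potentialPoly (m : ℕ) (α : ℕ → ℝ) : ℝ[X] :=
  ∑ n ∈ Finset.range (m + 1), C (α n) * (C (1 / ((n : ℝ) + 2)) * Chebyshev.C ℝ (n + 2 : ℕ)
    - C (1 / (n : ℝ)) * Chebyshev.C ℝ n)

theorem derivative_potentialPoly (m : ℕ) (α : ℕ → ℝ) :
    derivative (potentialPoly m α)
      = ∑ n ∈ Finset.range (m + 1), C (α n) * Chebyshev.C ℝ (n + 1 : ℕ) := by
  unfold potentialPoly
  rw [derivative_sum]
  refine Finset.sum_congr rfl fun n _ => ?_
  rw [derivative_C_mul, derivative_sub, derivative_C_mul, derivative_C_mul,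
    derivative_chebyshev_C, derivative_chebyshev_C]
  congr 1
  have h1 : C (1 / ((n : ℝ) + 2)) * ((((n + 2 : ℕ) : ℤ) : ℝ[X])
      * Chebyshev.S ℝ (((n + 2 : ℕ) : ℤ) - 1)) = Chebyshev.S ℝ (n + 1) := by
    rw [← mul_assoc,
      show (((n + 2 : ℕ) : ℤ) : ℝ[X]) = C ((n : ℝ) + 2) by simp [show C (2 : ℝ) = 2 from rfl],
      ← C_mul,
      one_div_mul_cancel (by positivity), C_1, one_mul]
    congr 1
    push_cast
    ring
  have h2 : C (1 / (n : ℝ)) * (((n : ℤ) : ℝ[X]) * Chebyshev.S ℝ ((n : ℤ) - 1))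
      = Chebyshev.S ℝ (n - 1) := by
    rcases n.eq_zero_or_pos with rfl | hn
    · simp
    · rw [← mul_assoc, show ((n : ℤ) : ℝ[X]) = C (n : ℝ) by simp, ← C_mul,
        one_div_mul_cancel (by positivity), C_1, one_mul]
  rw [h1, h2]
  have h3 := X_mul_S_sub_two_mul_S (n : ℤ)
  have h4 := Chebyshev.S_add_one ℝ (n : ℤ)
  push_cast
  rw [← h3, h4]
  ring

theorem integral_sum_S_mul_sqrt (m : ℕ) (α : ℕ → ℝ) :
    (1 / π) * ∫ x in (-2 : ℝ)..2,
      (∑ n ∈ Finset.range (m + 1), C (α n) * Chebyshev.S ℝ n).eval x * √(4 - x ^ 2)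
      = 2 * α 0 := by
  simp only [eval_finsetSum, eval_mul, eval_C, Finset.sum_mul]
  rw [intervalIntegral.integral_finsetSum
    fun i _ => Continuous.intervalIntegrable (by fun_prop) _ _]
  simp only [mul_assoc, intervalIntegral.integral_const_mul, integral_S_mul_sqrt]
  rw [Finset.sum_eq_single 0 (fun n _ hn => by simp [hn]) (by simp)]
  simp
  field_simp

theorem derivative_eq_of_secondary (m : ℕ) (α : ℕ → ℝ) (Φ : ℝ[X])
    (hΦ : ∀ z : ℝ, (derivative Φ).eval z
      = z * (∑ n ∈ Finset.range (m + 1), C (α n) * Chebyshev.S ℝ n).eval z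
        - secondary (∑ n ∈ Finset.range (m + 1), C (α n) * Chebyshev.S ℝ n) z) :
    Φ = C ((Φ - potentialPoly m α).coeff 0) + potentialPoly m α := by
  have hd : derivative (Φ - potentialPoly m α) = 0 := by
    rw [derivative_sub, sub_eq_zero, derivative_potentialPoly]
    refine Polynomial.funext fun z => ?_
    rw [hΦ, secondary_sum]
    simp only [eval_finsetSum, eval_mul, eval_C, Finset.mul_sum, ← Finset.sum_sub_distrib]
    refine Finset.sum_congr rfl fun n _ => ?_
    have h3 := congrArg (Polynomial.eval z) (X_mul_S_sub_two_mul_S (n : ℤ))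
    simp only [eval_sub, eval_mul, eval_X, eval_ofNat] at h3
    rw [secondary_S]
    push_cast
    rw [← h3]
    ring
  rw [← eq_C_of_derivative_eq_zero hd]
  ring

theorem integral_cos_int_mul_two_pi (n : ℤ) :
    ∫ θ in (0 : ℝ)..2 * π, Real.cos (n * θ) = if n = 0 then 2 * π else 0 := by
  split_ifs with h
  · simp [h]
  · rw [intervalIntegral.integral_comp_mul_left (fun x => Real.cos x) (by exact_mod_cast h)]
    have : Real.sin (n * (2 * π)) = 0 := by
      rw [← mul_assoc, mul_comm (n : ℝ) 2]
      exact_mod_cast Real.sin_int_mul_pi (2 * n)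
    simp [this]

theorem integral_sin_int_mul_two_pi (n : ℤ) :
    ∫ θ in (0 : ℝ)..2 * π, Real.sin (n * θ) = 0 := by
  rcases eq_or_ne n 0 with rfl | h
  · simp
  · rw [intervalIntegral.integral_comp_mul_left (fun x => Real.sin x) (by exact_mod_cast h)]
    simp [Real.cos_int_mul_two_pi]

theorem integral_two_mul_cos_mul_re (k j : ℕ) (b : ℂ) :
    ∫ θ in (0 : ℝ)..2 * π, 2 * Real.cos (k * θ) * ((b * Complex.exp (θ * Complex.I) ^ j) / j).re
      = if j = k then 2 * π * b.re / k else 0 := by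
  rcases eq_or_ne j 0 with rfl | hj
  · split_ifs with h
    · simp [← h]
    · simp
  have hexp : ∀ θ : ℝ, ((b * Complex.exp (θ * Complex.I) ^ j) / j).re
      = (b.re * Real.cos (j * θ) - b.im * Real.sin (j * θ)) / j := by
    intro θ
    rw [← Complex.exp_nat_mul, Complex.div_natCast_re, Complex.mul_re,
      show (j : ℂ) * (θ * Complex.I) = ((j * θ : ℝ) : ℂ) * Complex.I by push_cast; ring,
      Complex.exp_ofReal_mul_I_re, Complex.exp_ofReal_mul_I_im]
  have hI : ∀ θ : ℝ, 2 * Real.cos (k * θ) * ((b * Complex.exp (θ * Complex.I) ^ j) / j).re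
      = (b.re / j) * (Real.cos (((k - j : ℤ) : ℝ) * θ) + Real.cos (((k + j : ℤ) : ℝ) * θ))
        - (b.im / j) * (Real.sin (((k + j : ℤ) : ℝ) * θ) - Real.sin (((k - j : ℤ) : ℝ) * θ)) := by
    intro θ
    rw [hexp]
    push_cast
    rw [sub_mul, add_mul, Real.cos_sub, Real.cos_add, Real.sin_sub, Real.sin_add]
    ring
  simp only [hI]
  rw [intervalIntegral.integral_sub (Continuous.intervalIntegrable (by fun_prop) _ _)
    (Continuous.intervalIntegrable (by fun_prop) _ _), intervalIntegral.integral_const_mul,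
    intervalIntegral.integral_const_mul,
    intervalIntegral.integral_sub (Continuous.intervalIntegrable (by fun_prop) _ _)
    (Continuous.intervalIntegrable (by fun_prop) _ _),
    intervalIntegral.integral_add (Continuous.intervalIntegrable (by fun_prop) _ _)
    (Continuous.intervalIntegrable (by fun_prop) _ _),
    integral_cos_int_mul_two_pi, integral_cos_int_mul_two_pi, integral_sin_int_mul_two_pi,
    integral_sin_int_mul_two_pi, if_neg (by omega : ¬ ((k : ℤ) + j = 0))]
  rcases eq_or_ne j k with rfl | hjk
  · simp
    ring
  · rw [if_neg (by omega), if_neg hjk]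
    simp

theorem one_sub_mul_exp_ne_zero {c : ℂ} (hc : ‖c‖ < 1) (θ : ℝ) :
    1 - c * Complex.exp (θ * Complex.I) ≠ 0 := by
  intro h
  have h1 := congrArg norm (sub_eq_zero.1 h)
  rw [norm_one, norm_mul, Complex.norm_exp_ofReal_mul_I, mul_one] at h1
  linarith

theorem continuous_log_norm_one_sub {c : ℂ} (hc : ‖c‖ < 1) :
    Continuous fun θ : ℝ => Real.log ‖1 - c * Complex.exp (θ * Complex.I)‖ := by
  refine Continuous.log (by fun_prop) fun θ => norm_ne_zero_iff.2 (one_sub_mul_exp_ne_zero hc θ)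

/-- Fourier cosine coefficients of `θ ↦ log |1 - c e^{iθ}|`. -/
theorem integral_cos_mul_log_norm_one_sub (k : ℕ) {c : ℂ} (hc : ‖c‖ < 1) :
    ∫ θ in (0 : ℝ)..2 * π,
      2 * Real.cos (k * θ) * Real.log ‖1 - c * Complex.exp (θ * Complex.I)‖
      = -(2 * π * (c ^ k).re / k) := by
  have hnorm : ∀ θ : ℝ, ‖c * Complex.exp (θ * Complex.I)‖ = ‖c‖ := fun θ => by
    rw [norm_mul, Complex.norm_exp_ofReal_mul_I, mul_one]
  have hsum : ∀ θ : ℝ, HasSum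
      (fun j : ℕ => 2 * Real.cos (k * θ) * ((c ^ j * Complex.exp (θ * Complex.I) ^ j) / j).re)
      (-(2 * Real.cos (k * θ) * Real.log ‖1 - c * Complex.exp (θ * Complex.I)‖)) := by
    intro θ
    have h := Complex.hasSum_re
      (Complex.hasSum_taylorSeries_neg_log (z := c * Complex.exp (θ * Complex.I))
        (by rwa [hnorm]))
    rw [Complex.neg_re, Complex.log_re] at h
    have h' := h.mul_left (2 * Real.cos (k * θ))
    simpa only [mul_pow, mul_neg] using h'
  have hI := intervalIntegral.hasSum_integral_of_dominated_convergence
    (μ := MeasureTheory.volume) (a := 0) (b := 2 * π)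
    (F := fun (j : ℕ) (θ : ℝ) =>
      2 * Real.cos (k * θ) * ((c ^ j * Complex.exp (θ * Complex.I) ^ j) / j).re)
    (f := fun θ : ℝ => -(2 * Real.cos (k * θ) * Real.log ‖1 - c * Complex.exp (θ * Complex.I)‖))
    (fun j _ => 2 * ‖c‖ ^ j) (fun j => Continuous.aestronglyMeasurable (by fun_prop))
    (fun j => Filter.Eventually.of_forall fun θ _ => by
      have h1 : ‖(c ^ j * Complex.exp (θ * Complex.I) ^ j) / j‖ ≤ ‖c‖ ^ j := by
        rw [← mul_pow, norm_div, norm_pow, hnorm, Complex.norm_natCast]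
        rcases j.eq_zero_or_pos with rfl | hj
        · simp
        · exact div_le_self (by positivity) (by exact_mod_cast hj)
      have h2 := (Complex.abs_re_le_norm _).trans h1
      rw [Real.norm_eq_abs, abs_mul, abs_mul, abs_two]
      have h3 := Real.abs_cos_le_one (k * θ)
      have h4 : 0 ≤ ‖c‖ ^ j := by positivity
      calc _ ≤ 2 * 1 * ‖c‖ ^ j := by gcongr
        _ = _ := by ring)
    (Filter.Eventually.of_forall fun θ _ =>
      (summable_geometric_of_lt_one (norm_nonneg c) hc).mul_left 2)
    (by simp)
    (Filter.Eventually.of_forall fun θ _ => hsum θ)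
  simp only [integral_two_mul_cos_mul_re] at hI
  have hk : HasSum (fun j : ℕ => if j = k then 2 * π * (c ^ j).re / k else 0)
      (2 * π * (c ^ k).re / k) := by
    convert hasSum_ite_eq k (2 * π * (c ^ k).re / k) using 2 with j
    split_ifs with h
    · rw [h]
    · rfl
  have := hI.unique hk
  rw [intervalIntegral.integral_neg] at this
  linarith

theorem log_norm_two_mul_cos_sub {v : ℂ} (hv : 1 < ‖v‖) (θ : ℝ) :
    Real.log ‖((2 * Real.cos θ : ℝ) : ℂ) - (v + v⁻¹)‖
      = Real.log ‖v‖ + Real.log ‖1 - v⁻¹ * Complex.exp (θ * Complex.I)‖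
        + Real.log ‖1 - (starRingEnd ℂ) v⁻¹ * Complex.exp (θ * Complex.I)‖ := by
  have hv0 : v ≠ 0 := norm_pos_iff.1 (by linarith)
  have hi : ‖v⁻¹‖ < 1 := by
    rw [norm_inv]
    exact inv_lt_one_of_one_lt₀ hv
  have hconj : ‖1 - (starRingEnd ℂ) v⁻¹ * Complex.exp (θ * Complex.I)‖
      = ‖1 - v⁻¹ * Complex.exp (-(θ * Complex.I))‖ := by
    rw [← Complex.norm_conj]
    congr 1
    simp [← Complex.exp_conj]
  have hne : ‖1 - (starRingEnd ℂ) v⁻¹ * Complex.exp (θ * Complex.I)‖ ≠ 0 :=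
    norm_ne_zero_iff.2 (one_sub_mul_exp_ne_zero (by rwa [Complex.norm_conj]) θ)
  rw [← Real.log_mul (norm_ne_zero_iff.2 hv0)
    (norm_ne_zero_iff.2 (one_sub_mul_exp_ne_zero hi θ)), ← Real.log_mul
    (mul_ne_zero (norm_ne_zero_iff.2 hv0) (norm_ne_zero_iff.2 (one_sub_mul_exp_ne_zero hi θ))) hne,
    hconj, ← norm_mul, ← norm_mul, ← norm_neg]
  congr 2
  have h1 : ((2 * Real.cos θ : ℝ) : ℂ)
      = Complex.exp (θ * Complex.I) + Complex.exp (-(θ * Complex.I)) := by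
    push_cast
    rw [Complex.two_cos]
    ring_nf
  have h2 : Complex.exp (θ * Complex.I) * Complex.exp (-(θ * Complex.I)) = 1 := by
    rw [← Complex.exp_add]
    simp
  rw [h1]
  generalize Complex.exp (θ * Complex.I) = x at *
  generalize Complex.exp (-(θ * Complex.I)) = y at *
  field_simp
  linear_combination -h2

theorem integral_cos_mul_log_norm_two_mul_cos_sub (k : ℕ) {v : ℂ} (hv : 1 < ‖v‖) :
    ∫ θ in (0 : ℝ)..2 * π,
      2 * Real.cos (k * θ) * Real.log ‖((2 * Real.cos θ : ℝ) : ℂ) - (v + v⁻¹)‖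
      = 2 * π * ((if k = 0 then 2 * Real.log ‖v‖ else 0) - 2 / k * (v⁻¹ ^ k).re) := by
  have hi : ‖v⁻¹‖ < 1 := by
    rw [norm_inv]
    exact inv_lt_one_of_one_lt₀ hv
  have hi' : ‖(starRingEnd ℂ) v⁻¹‖ < 1 := by rwa [Complex.norm_conj]
  have c1 := continuous_log_norm_one_sub hi
  have c2 := continuous_log_norm_one_sub hi'
  have h0 : ∫ θ in (0 : ℝ)..2 * π, 2 * Real.cos (k * θ) * Real.log ‖v‖
      = 2 * π * (if k = 0 then 2 * Real.log ‖v‖ else 0) := by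
    have := integral_cos_int_mul_two_pi k
    push_cast at this
    rw [intervalIntegral.integral_mul_const, intervalIntegral.integral_const_mul, this]
    split_ifs with h h' h'
    · ring
    · exact absurd (by exact_mod_cast h) h'
    · exact absurd (by exact_mod_cast h') h
    · ring
  simp only [log_norm_two_mul_cos_sub hv, mul_add]
  rw [intervalIntegral.integral_add (Continuous.intervalIntegrable (by fun_prop) _ _)
    (Continuous.intervalIntegrable (by fun_prop) _ _),
    intervalIntegral.integral_add (Continuous.intervalIntegrable (by fun_prop) _ _)
    (Continuous.intervalIntegrable (by fun_prop) _ _), h0,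
    integral_cos_mul_log_norm_one_sub k hi, integral_cos_mul_log_norm_one_sub k hi',
    ← map_pow, Complex.conj_re]
  ring

/-- The Chebyshev potential `∫ log |x - z| A(x) √(4 - x²) dx / π` for `A = ∑ αₙ Sₙ` at
`z = v + v⁻¹`, in the coordinate `v`. -/
def joukowskiPotential (m : ℕ) (α : ℕ → ℝ) (v : ℂ) : ℝ :=
  2 * α 0 * Real.log ‖v‖ + ∑ n ∈ Finset.range (m + 1),
    α n * (2 / ((n : ℝ) + 2) * (v⁻¹ ^ (n + 2)).re - 2 / (n : ℝ) * (v⁻¹ ^ n).re)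

theorem norm_two_mul_cos_sub_ne_zero {v : ℂ} (hv : 1 < ‖v‖) (θ : ℝ) :
    ‖((2 * Real.cos θ : ℝ) : ℂ) - (v + v⁻¹)‖ ≠ 0 := by
  have hv0 : v ≠ 0 := norm_pos_iff.1 (by linarith)
  have hi : ‖v⁻¹‖ < 1 := by
    rw [norm_inv]
    exact inv_lt_one_of_one_lt₀ hv
  rw [norm_ne_zero_iff]
  have h1 : ((2 * Real.cos θ : ℝ) : ℂ)
      = Complex.exp (θ * Complex.I) + Complex.exp (((-θ : ℝ) : ℂ) * Complex.I) := by
    push_cast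
    rw [Complex.two_cos]
  have h2 : Complex.exp (θ * Complex.I) * Complex.exp (((-θ : ℝ) : ℂ) * Complex.I) = 1 := by
    rw [← Complex.exp_add]
    simp
  have h3 := mul_ne_zero (mul_ne_zero hv0 (one_sub_mul_exp_ne_zero hi θ))
    (one_sub_mul_exp_ne_zero hi (-θ))
  rw [h1]
  intro h
  apply h3
  generalize Complex.exp (θ * Complex.I) = x at *
  generalize Complex.exp (((-θ : ℝ) : ℂ) * Complex.I) = y at *
  field_simp
  field_simp at h
  linear_combination -h + h2

theorem integral_weight_mul_log_norm (m : ℕ) (α : ℕ → ℝ) {v : ℂ} (hv : 1 < ‖v‖) :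
    ∫ θ in (0 : ℝ)..2 * π,
      ((∑ n ∈ Finset.range (m + 1), C (α n) * Chebyshev.S ℝ n).eval (2 * Real.cos θ)
        * (4 * Real.sin θ ^ 2)) * Real.log ‖((2 * Real.cos θ : ℝ) : ℂ) - (v + v⁻¹)‖
      = 2 * π * joukowskiPotential m α v := by
  have hc : Continuous fun θ : ℝ => Real.log ‖((2 * Real.cos θ : ℝ) : ℂ) - (v + v⁻¹)‖ :=
    Continuous.log (by fun_prop) (norm_two_mul_cos_sub_ne_zero hv)
  have hterm : ∀ θ : ℝ, ((∑ n ∈ Finset.range (m + 1), C (α n) * Chebyshev.S ℝ n).eval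
        (2 * Real.cos θ) * (4 * Real.sin θ ^ 2))
        * Real.log ‖((2 * Real.cos θ : ℝ) : ℂ) - (v + v⁻¹)‖
      = ∑ n ∈ Finset.range (m + 1), α n *
        (2 * Real.cos (n * θ) * Real.log ‖((2 * Real.cos θ : ℝ) : ℂ) - (v + v⁻¹)‖
        - 2 * Real.cos ((n + 2 : ℕ) * θ)
          * Real.log ‖((2 * Real.cos θ : ℝ) : ℂ) - (v + v⁻¹)‖) := by
    intro θ
    simp only [eval_finsetSum, eval_mul, eval_C, Finset.sum_mul]
    refine Finset.sum_congr rfl fun n _ => ?_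
    rw [mul_assoc (α n), S_two_mul_cos_mul_sin_sq]
    ring
  simp only [hterm]
  rw [intervalIntegral.integral_finsetSum
    fun i _ => Continuous.intervalIntegrable (by fun_prop) _ _]
  have hI : ∀ n : ℕ, ∫ θ in (0 : ℝ)..2 * π, α n *
        (2 * Real.cos (n * θ) * Real.log ‖((2 * Real.cos θ : ℝ) : ℂ) - (v + v⁻¹)‖
        - 2 * Real.cos ((n + 2 : ℕ) * θ)
          * Real.log ‖((2 * Real.cos θ : ℝ) : ℂ) - (v + v⁻¹)‖)
      = 2 * π * (α n * (if n = 0 then 2 * Real.log ‖v‖ else 0)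
        + α n * (2 / ((n : ℝ) + 2) * (v⁻¹ ^ (n + 2)).re - 2 / (n : ℝ) * (v⁻¹ ^ n).re)) := by
    intro n
    rw [intervalIntegral.integral_const_mul, intervalIntegral.integral_sub
      (Continuous.intervalIntegrable (by fun_prop) _ _)
      (Continuous.intervalIntegrable (by fun_prop) _ _),
      integral_cos_mul_log_norm_two_mul_cos_sub _ hv,
      integral_cos_mul_log_norm_two_mul_cos_sub _ hv, if_neg (by omega : ¬ (n + 2 = 0))]
    push_cast
    ring
  simp only [hI]
  rw [← Finset.mul_sum, Finset.sum_add_distrib, joukowskiPotential]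
  congr 2
  rw [Finset.sum_eq_single 0 (fun n _ hn => by simp [hn]) (by simp)]
  simp
  ring

theorem chebyshev_C_eval_add_inv {v : ℝ} (hv : v ≠ 0) : ∀ n : ℕ,
    (Chebyshev.C ℝ n).eval (v + v⁻¹) = v ^ n + v⁻¹ ^ n
  | 0 => by norm_num
  | 1 => by simp
  | n + 2 => by
    have h := Chebyshev.C_add_two ℝ n
    have h1 := chebyshev_C_eval_add_inv hv (n + 1)
    have h0 := chebyshev_C_eval_add_inv hv n
    push_cast at h h1 ⊢
    rw [h, eval_sub, eval_mul, eval_X, h1, h0]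
    have : v * v⁻¹ = 1 := mul_inv_cancel₀ hv
    linear_combination (v ^ n + v⁻¹ ^ n) * this

theorem chebyshev_S_eval_add_inv {v : ℝ} (hv : v ≠ 0) : ∀ n : ℕ,
    (Chebyshev.S ℝ n).eval (v + v⁻¹) * (v - v⁻¹) = v ^ (n + 1) - v⁻¹ ^ (n + 1)
  | 0 => by simp
  | 1 => by
    simp
    ring
  | n + 2 => by
    have h := Chebyshev.S_add_two ℝ n
    have h1 := chebyshev_S_eval_add_inv hv (n + 1)
    have h0 := chebyshev_S_eval_add_inv hv n
    push_cast at h h1 ⊢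
    rw [h, eval_sub, eval_mul, eval_X, sub_mul, mul_assoc, h1, h0]
    have : v * v⁻¹ = 1 := mul_inv_cancel₀ hv
    linear_combination (v ^ (n + 1) - v⁻¹ ^ (n + 1)) * this

/-- A primitive of `v ^ (n - 1) + v ^ (-n - 1)` which vanishes at `±1`. -/
def powPrimitive (n : ℕ) (v : ℝ) : ℝ :=
  if n = 0 then 2 * Real.log v else (v ^ n - v⁻¹ ^ n) / n

theorem hasDerivAt_powPrimitive (n : ℕ) {v : ℝ} (hv : v ≠ 0) :
    HasDerivAt (powPrimitive n) ((v ^ n + v⁻¹ ^ n) / v) v := by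
  rcases eq_or_ne n 0 with rfl | hn
  · have h : powPrimitive 0 = fun v : ℝ => 2 * Real.log v := by
      ext v
      simp [powPrimitive]
    rw [h]
    refine ((Real.hasDerivAt_log hv).const_mul 2).congr_deriv ?_
    rw [pow_zero, pow_zero, div_eq_mul_inv]
    ring
  · have h : powPrimitive n = fun v : ℝ => (v ^ n - v⁻¹ ^ n) / n := by
      ext v
      simp [powPrimitive, hn]
    rw [h]
    have hn' : (n : ℝ) ≠ 0 := by exact_mod_cast hn
    refine (((hasDerivAt_pow n v).fun_sub ((hasDerivAt_inv hv).fun_pow n)).div_const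
      (n : ℝ)).congr_deriv ?_
    obtain ⟨k, rfl⟩ := Nat.exists_eq_succ_of_ne_zero hn
    simp only [Nat.succ_eq_add_one, Nat.add_sub_cancel, inv_pow]
    field_simp
    ring

theorem potentialPoly_eval_sub_joukowskiPotential (m : ℕ) (α : ℕ → ℝ) {v : ℝ} (hv : v ≠ 0) :
    (potentialPoly m α).eval (v + v⁻¹) - joukowskiPotential m α v
      = ∑ n ∈ Finset.range (m + 1), α n * (powPrimitive (n + 2) v - powPrimitive n v) := by
  have hlog : 2 * α 0 * Real.log ‖(v : ℂ)‖
      = ∑ n ∈ Finset.range (m + 1), α n * (if n = 0 then 2 * Real.log v else 0) := by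
    rw [Finset.sum_eq_single 0 (fun n _ hn => by simp [hn]) (by simp)]
    simp
    ring
  rw [joukowskiPotential, hlog, potentialPoly, ← Finset.sum_add_distrib, eval_finsetSum,
    ← Finset.sum_sub_distrib]
  refine Finset.sum_congr rfl fun n _ => ?_
  simp only [eval_mul, eval_sub, eval_C, chebyshev_C_eval_add_inv hv, ← Complex.ofReal_inv,
    ← Complex.ofReal_pow, Complex.ofReal_re, powPrimitive]
  rw [if_neg (by omega : ¬ (n + 2 = 0))]
  split_ifs with h
  · subst h
    simp
    ring
  · push_cast
    ring

theorem joukowskiPotential_le_of_real {m : ℕ} {α : ℕ → ℝ}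
    (hA : ∀ x : ℝ, 0 ≤ (∑ n ∈ Finset.range (m + 1), C (α n) * Chebyshev.S ℝ n).eval x)
    {v : ℝ} (hv : 1 ≤ |v|) :
    joukowskiPotential m α v ≤ (potentialPoly m α).eval (v + v⁻¹) := by
  rw [← sub_nonneg, potentialPoly_eval_sub_joukowskiPotential m α (by
    rintro rfl
    norm_num at hv)]
  set D : ℝ → ℝ := fun v =>
    ∑ n ∈ Finset.range (m + 1), α n * (powPrimitive (n + 2) v - powPrimitive n v) with hD
  have hderiv : ∀ v : ℝ, v ≠ 0 → HasDerivAt D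
      ((∑ n ∈ Finset.range (m + 1), C (α n) * Chebyshev.S ℝ n).eval (v + v⁻¹)
        * (v - v⁻¹) ^ 2 / v) v := by
    intro v hv
    have h := HasDerivAt.fun_sum (u := Finset.range (m + 1))
      fun n (_ : n ∈ Finset.range (m + 1)) =>
      ((hasDerivAt_powPrimitive (n + 2) hv).fun_sub (hasDerivAt_powPrimitive n hv)).const_mul (α n)
    refine h.congr_deriv ?_
    rw [eval_finsetSum, Finset.sum_mul, Finset.sum_div]
    refine Finset.sum_congr rfl fun n _ => ?_
    rw [eval_mul, eval_C, sq, ← mul_assoc, mul_assoc (α n), chebyshev_S_eval_add_inv hv]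
    have : v * v⁻¹ = 1 := mul_inv_cancel₀ hv
    rw [← sub_div, mul_div_assoc, mul_assoc]
    congr 1
    rw [← mul_div_assoc]
    congr 1
    linear_combination (v ^ n + v⁻¹ ^ n) * this
  have hlog1 : ∀ n, powPrimitive n 1 = 0 := fun n => by simp [powPrimitive]
  have hlogm1 : ∀ n, powPrimitive n (-1) = 0 := fun n => by simp [powPrimitive, inv_neg]
  rcases le_abs.1 hv with h | h
  · have hmono : MonotoneOn D (Set.Ici 1) := by
      refine monotoneOn_of_hasDerivWithinAt_nonneg (convex_Ici 1) (fun x hx =>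
        (hderiv x (by have : (1 : ℝ) ≤ x := hx; positivity)).continuousAt.continuousWithinAt)
        (fun x hx => (hderiv x ?_).hasDerivWithinAt) fun x hx => ?_
      all_goals
        rw [interior_Ici] at hx
        have hx' : 0 < x := by have : (1 : ℝ) < x := hx; linarith
      · exact hx'.ne'
      · exact div_nonneg (mul_nonneg (hA _) (sq_nonneg _)) hx'.le
    have := hmono (Set.mem_Ici.2 le_rfl) (Set.mem_Ici.2 h) h
    simpa [hD, hlog1] using this
  · have hanti : AntitoneOn D (Set.Iic (-1)) := by
      refine antitoneOn_of_hasDerivWithinAt_nonpos (convex_Iic (-1)) (fun x hx =>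
        (hderiv x ?_).continuousAt.continuousWithinAt)
        (fun x hx => (hderiv x ?_).hasDerivWithinAt) fun x hx => ?_
      · have : x ≤ -1 := hx
        linarith
      all_goals
        rw [interior_Iic] at hx
        have hx' : x < 0 := by have : x < -1 := hx; linarith
      · exact hx'.ne
      · exact div_nonpos_of_nonneg_of_nonpos (mul_nonneg (hA _) (sq_nonneg _)) hx'.le
    have hv1 : v ≤ -1 := by linarith
    have := hanti (Set.mem_Iic.2 hv1) (Set.mem_Iic.2 le_rfl) hv1
    simpa [hD, hlogm1] using this

theorem joukowskiPotential_eq_of_norm_eq_one (m : ℕ) (α : ℕ → ℝ) {v : ℂ} (hv : ‖v‖ = 1) :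
    joukowskiPotential m α v = (potentialPoly m α).eval (v + v⁻¹).re := by
  obtain ⟨φ, rfl⟩ : ∃ φ : ℝ, v = Complex.exp (φ * Complex.I) := by
    refine ⟨v.arg, ?_⟩
    have := Complex.norm_mul_exp_arg_mul_I v
    rw [hv] at this
    simpa using this.symm
  have hre : ∀ n : ℕ, ((Complex.exp (φ * Complex.I))⁻¹ ^ n).re = Real.cos (n * φ) := by
    intro n
    rw [← Complex.exp_neg, ← Complex.exp_nat_mul,
      show (n : ℂ) * -(φ * Complex.I) = ((-(n * φ) : ℝ) : ℂ) * Complex.I by push_cast; ring,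
      Complex.exp_ofReal_mul_I_re, Real.cos_neg]
  have h1 := hre 1
  rw [pow_one, Nat.cast_one, one_mul] at h1
  have hsum : (Complex.exp (φ * Complex.I) + (Complex.exp (φ * Complex.I))⁻¹).re
      = 2 * Real.cos φ := by
    rw [Complex.add_re, h1, Complex.exp_ofReal_mul_I_re]
    ring
  rw [joukowskiPotential, hsum, hv, potentialPoly, eval_finsetSum]
  simp only [Real.log_one, mul_zero, zero_add]
  refine Finset.sum_congr rfl fun n _ => ?_
  simp only [eval_mul, eval_sub, eval_C, hre]
  have h2 := Chebyshev.C_two_mul_real_cos φ (n + 2 : ℕ)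
  have h0 := Chebyshev.C_two_mul_real_cos φ n
  push_cast at h0 h2 ⊢
  rw [h0, h2]
  ring

theorem im_add_inv (v : ℂ) : (v + v⁻¹).im = v.im * (1 - (‖v‖ ^ 2)⁻¹) := by
  rw [Complex.add_im, Complex.inv_im, Complex.normSq_eq_norm_sq]
  ring

theorem joukowskiPotential_le_of_im_eq_zero {m : ℕ} {α : ℕ → ℝ}
    (hA : ∀ x : ℝ, 0 ≤ (∑ n ∈ Finset.range (m + 1), C (α n) * Chebyshev.S ℝ n).eval x)
    {v : ℂ} (hv : 1 ≤ ‖v‖) (him : (v + v⁻¹).im = 0) :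
    joukowskiPotential m α v ≤ (potentialPoly m α).eval (v + v⁻¹).re := by
  rw [im_add_inv] at him
  rcases mul_eq_zero.1 him with h | h
  · have hre : ((v.re : ℝ) : ℂ) = v := Complex.ext rfl h.symm
    have h1 := joukowskiPotential_le_of_real hA (v := v.re) (by
      rw [← Real.norm_eq_abs, ← Complex.norm_real, hre]
      exact hv)
    rw [hre] at h1
    convert h1 using 2
    rw [← hre, ← Complex.ofReal_inv, ← Complex.ofReal_add, Complex.ofReal_re, Complex.ofReal_re]
  · have h1 : ‖v‖ ^ 2 = 1 := by
      rw [← inv_inj]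
      linarith
    exact (joukowskiPotential_eq_of_norm_eq_one m α
      ((pow_eq_one_iff_of_nonneg (norm_nonneg v) two_ne_zero).1 h1)).le

theorem exists_add_inv_eq {z : ℂ} (hz : z.im ≠ 0) : ∃ v : ℂ, 1 < ‖v‖ ∧ v + v⁻¹ = z := by
  obtain ⟨s, hs⟩ := IsAlgClosed.exists_eq_mul_self (z ^ 2 - 4)
  set w := (z + s) / 2 with hw
  have hprod : w * ((z - s) / 2) = 1 := by
    rw [hw]
    linear_combination (1 / 4 : ℂ) * hs
  have hw0 : w ≠ 0 := left_ne_zero_of_mul_eq_one hprod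
  have hinv : w⁻¹ = (z - s) / 2 := inv_eq_of_mul_eq_one_right hprod
  have hsum : w + w⁻¹ = z := by
    rw [hinv, hw]
    ring
  rcases lt_trichotomy 1 ‖w‖ with h | h | h
  · exact ⟨w, h, hsum⟩
  · refine absurd ?_ hz
    rw [← hsum, im_add_inv, ← h]
    norm_num
  · refine ⟨w⁻¹, ?_, by rw [inv_inv, add_comm, hsum]⟩
    rw [norm_inv]
    exact (one_lt_inv₀ (norm_pos_iff.2 hw0)).2 h

/-- The smoothed logarithmic potential is dominated by the polynomial potential up to an
arbitrarily small error, uniformly on bounded sets. -/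
theorem exists_integral_log_norm_le {m : ℕ} {α : ℕ → ℝ}
    (hA : ∀ x : ℝ, 0 ≤ (∑ n ∈ Finset.range (m + 1), C (α n) * Chebyshev.S ℝ n).eval x)
    (R : ℝ) {η : ℝ} (hη : 0 < η) :
    ∃ δ : ℝ, 0 < δ ∧ ∀ l : ℝ, |l| ≤ R →
      ∫ θ in (0 : ℝ)..2 * π,
        ((∑ n ∈ Finset.range (m + 1), C (α n) * Chebyshev.S ℝ n).eval (2 * Real.cos θ)
        * (4 * Real.sin θ ^ 2))
          * Real.log ‖((2 * Real.cos θ : ℝ) : ℂ) + δ * Complex.I - l‖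
      ≤ 2 * π * ((potentialPoly m α).eval l + η) := by
  set D : ℂ → ℝ := fun v => (potentialPoly m α).eval (v + v⁻¹).re - joukowskiPotential m α v with hD
  set 𝒜 : Set ℂ := {v | 1 ≤ ‖v‖} ∩ Metric.closedBall 0 (R + 2) with h𝒜
  have h𝒜c : IsCompact 𝒜 :=
    (isCompact_closedBall (0 : ℂ) (R + 2)).inter_left (isClosed_le continuous_const continuous_norm)
  have h𝒜0 : ∀ v ∈ 𝒜, v ≠ 0 := fun v hv =>
    norm_pos_iff.1 (by have := hv.1; exact one_pos.trans_le this)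
  have hJ : ContinuousOn (fun v : ℂ => v + v⁻¹) 𝒜 :=
    continuousOn_id.add (continuousOn_id.inv₀ h𝒜0)
  have hDc : ContinuousOn D 𝒜 := by
    refine ((Polynomial.continuous _).comp_continuousOn
      (Complex.continuous_re.comp_continuousOn hJ)).sub ?_
    have hi : ContinuousOn (fun v : ℂ => v⁻¹) 𝒜 := continuousOn_id.inv₀ h𝒜0
    have hp : ∀ k : ℕ, ContinuousOn (fun v : ℂ => (v⁻¹ ^ k).re) 𝒜 := fun k =>
      Complex.continuous_re.comp_continuousOn (hi.pow k)
    have hl : ContinuousOn (fun v : ℂ => Real.log ‖v‖) 𝒜 :=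
      continuous_norm.continuousOn.log fun v hv => norm_ne_zero_iff.2 (h𝒜0 v hv)
    refine (continuousOn_const.mul hl).add (continuousOn_finsetSum _ fun n _ => ?_)
    exact continuousOn_const.mul ((continuousOn_const.mul (hp _)).sub
      (continuousOn_const.mul (hp _)))
  have hbad : IsCompact (𝒜 ∩ D ⁻¹' Set.Iic (-η)) :=
    h𝒜c.of_isClosed_subset (hDc.preimage_isClosed_of_isClosed h𝒜c.isClosed isClosed_Iic)
      Set.inter_subset_left
  obtain ⟨δ₀, hδ₀, hδ₀'⟩ : ∃ δ₀ : ℝ, 0 < δ₀ ∧ ∀ v ∈ 𝒜, |(v + v⁻¹).im| < δ₀ → -η < D v := by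
    rcases (𝒜 ∩ D ⁻¹' Set.Iic (-η)).eq_empty_or_nonempty with he | hne
    · refine ⟨1, one_pos, fun v hv _ => ?_⟩
      by_contra! h
      have : v ∈ 𝒜 ∩ D ⁻¹' Set.Iic (-η) := ⟨hv, h⟩
      rw [he] at this
      exact this
    · obtain ⟨w, hw, hmin⟩ := hbad.exists_isMinOn hne
        (f := fun v : ℂ => |(v + v⁻¹).im|)
        ((Complex.continuous_im.comp_continuousOn (hJ.mono Set.inter_subset_left)).abs)
      refine ⟨|(w + w⁻¹).im|, abs_pos.2 fun h0 => ?_, fun v hv hlt => ?_⟩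
      · have h1 := joukowskiPotential_le_of_im_eq_zero hA hw.1.1 h0
        have h2 : D w ≤ -η := hw.2
        simp only [hD] at h2
        linarith
      · by_contra! h
        exact absurd (hmin ⟨hv, h⟩ : |(w + w⁻¹).im| ≤ |(v + v⁻¹).im|) (not_le.2 hlt)
  refine ⟨min 1 (δ₀ / 2), by positivity, fun l hl => ?_⟩
  set δ : ℝ := min 1 (δ₀ / 2) with hδ
  have hδpos : 0 < δ := by positivity
  set z : ℂ := l - δ * Complex.I with hz
  have hzim : z.im = -δ := by simp [hz]
  have hzre : z.re = l := by simp [hz]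
  obtain ⟨v, hv, hvz⟩ := exists_add_inv_eq (z := z) (by rw [hzim]; linarith)
  have hznorm : ‖z‖ ≤ R + 1 := by
    calc ‖z‖ ≤ ‖(l : ℂ)‖ + ‖(δ : ℂ) * Complex.I‖ := norm_sub_le _ _
      _ ≤ R + 1 := by
        rw [norm_mul, Complex.norm_I, mul_one, Complex.norm_real, Complex.norm_real,
          Real.norm_eq_abs, Real.norm_eq_abs, abs_of_pos hδpos]
        exact add_le_add hl (min_le_left _ _)
  have hvA : v ∈ 𝒜 := by
    refine ⟨hv.le, ?_⟩
    rw [mem_closedBall_zero_iff, show v = z - v⁻¹ by rw [← hvz]; ring]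
    calc ‖z - v⁻¹‖ ≤ ‖z‖ + ‖v⁻¹‖ := norm_sub_le _ _
      _ ≤ (R + 1) + 1 := by
        refine add_le_add hznorm ?_
        rw [norm_inv]
        exact inv_le_one_of_one_le₀ hv.le
      _ = R + 2 := by ring
  have hDv := hδ₀' v hvA (by
    rw [hvz, hzim, abs_neg, abs_of_pos hδpos]
    exact (min_le_right _ _).trans_lt (by linarith))
  simp only [hD, hvz, hzre] at hDv
  have hI := integral_weight_mul_log_norm m α hv
  rw [hvz] at hI
  simp only [hz, ← sub_add, sub_add_eq_add_sub] at hI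
  rw [hI]
  refine mul_le_mul_of_nonneg_left ?_ (by positivity)
  linarith

theorem trace_aeval_eq_sum_eigenvalues {n : Type*} [Fintype n] [DecidableEq n]
    {A : Matrix n n ℝ} (hA : A.IsHermitian) (Φ : ℝ[X]) :
    (aeval A Φ).trace = ∑ i, Φ.eval (hA.eigenvalues i) := by
  conv_lhs => rw [hA.spectral_theorem]
  set U := hA.eigenvectorUnitary
  have h1 := Polynomial.aeval_algHom_apply
    (Unitary.conjStarAlgAut ℝ (Matrix n n ℝ) U).toAlgEquiv.toAlgHom
    (Matrix.diagonal (RCLike.ofReal ∘ hA.eigenvalues)) Φ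
  have h2 := Polynomial.aeval_algHom_apply (Matrix.diagonalAlgHom ℝ (n := n) (α := ℝ))
    hA.eigenvalues Φ
  have h3 : ∀ B : Matrix n n ℝ,
      ((Unitary.conjStarAlgAut ℝ (Matrix n n ℝ) U) B).trace = B.trace := by
    intro B
    rw [Unitary.conjStarAlgAut_apply, Matrix.mul_assoc, Matrix.trace_mul_comm, Matrix.mul_assoc]
    simp
  have h4 : (aeval (Matrix.diagonal (RCLike.ofReal ∘ hA.eigenvalues) : Matrix n n ℝ) Φ)
      = Matrix.diagonal (aeval hA.eigenvalues Φ) := h2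
  have h5 : aeval (Unitary.conjStarAlgAut ℝ (Matrix n n ℝ) U
      (Matrix.diagonal (RCLike.ofReal ∘ hA.eigenvalues))) Φ
      = Unitary.conjStarAlgAut ℝ (Matrix n n ℝ) U
        (aeval (Matrix.diagonal (RCLike.ofReal ∘ hA.eigenvalues) : Matrix n n ℝ) Φ) := h1
  rw [h5, h3, h4, Matrix.trace_diagonal]
  refine Finset.sum_congr rfl fun i _ => ?_
  simp

theorem det_smul_one_sub_map_ofReal {n : Type*} [Fintype n] [DecidableEq n]
    {A : Matrix n n ℝ} (hA : A.IsHermitian) (z : ℂ) :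
    (z • (1 : Matrix n n ℂ) - A.map Complex.ofReal).det
      = ∏ i, (z - (hA.eigenvalues i : ℂ)) := by
  have h : (A.map Complex.ofReal).charpoly
      = ∏ i, (X - C ((hA.eigenvalues i : ℝ) : ℂ)) := by
    have h1 := Matrix.charpoly_map A Complex.ofRealHom
    rw [hA.charpoly_eq, Polynomial.map_prod] at h1
    simpa using! h1
  have h2 := Matrix.eval_charpoly (A.map Complex.ofReal) z
  rw [h, eval_prod] at h2
  simp only [eval_sub, eval_X, eval_C] at h2
  rw [h2, Matrix.scalar_apply, Matrix.smul_one_eq_diagonal]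

open scoped Matrix in
/-- A resolvent bound for the determinant of a tridiagonal matrix, from the corner of its
adjugate. -/
theorem mul_prod_le_norm_det {n : ℕ} {A : Matrix (Fin (n + 1)) (Fin (n + 1)) ℝ}
    (hA : A.IsHermitian) (htri : ∀ i j : Fin (n + 1), (j : ℕ) + 1 < i → A i j = 0)
    {z : ℂ} (hz : 0 < z.im) :
    z.im * ∏ i : Fin n, |A i.succ i.castSucc|
      ≤ ‖(z • (1 : Matrix (Fin (n + 1)) (Fin (n + 1)) ℂ) - A.map Complex.ofReal).det‖ := by
  set B := z • (1 : Matrix (Fin (n + 1)) (Fin (n + 1)) ℂ) - A.map Complex.ofReal with hB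
  set w : Fin (n + 1) → ℂ := fun i => B.adjugate i 0 with hw
  have hBw : B *ᵥ w = B.det • Pi.single 0 1 := by
    have h : B * B.adjugate = B.det • 1 := Matrix.mul_adjugate B
    ext i
    have h' := congrFun (congrFun h i) 0
    rw [Matrix.mul_apply] at h'
    simpa [Matrix.mulVec, dotProduct, hw, Matrix.one_apply, Pi.single_apply] using h'
  have hcorner : ‖w (Fin.last n)‖ = ∏ i : Fin n, |A i.succ i.castSucc| := by
    rw [hw]
    simp only
    rw [Matrix.adjugate_fin_succ_eq_det_submatrix, Matrix.det_of_isUpperTriangular]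
    · rw [norm_mul, norm_pow, norm_neg, norm_one, one_pow, one_mul, norm_prod]
      refine Finset.prod_congr rfl fun i _ => ?_
      simp [hB, Fin.ext_iff]
    · intro i j hij
      have hij' : (j : ℕ) < i := hij
      have h1 : A i.succ j.castSucc = 0 := htri _ _ (by simpa using hij')
      simp only [Matrix.submatrix_apply, Fin.succAbove_zero, Fin.succAbove_last, hB,
        Matrix.sub_apply, Matrix.smul_apply, Matrix.map_apply, h1, Matrix.one_apply]
      rw [if_neg (by rw [Fin.ext_iff]; simp; omega)]
      simp
  have hAC : (A.map Complex.ofReal).IsHermitian :=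
    hA.map _ fun x => by simp
  have hquad : z.im * ∑ i, ‖w i‖ ^ 2 ≤ ‖B.det‖ * ‖w 0‖ := by
    have h1 : star w ⬝ᵥ (B *ᵥ w) = star (w 0) * B.det := by
      rw [hBw]
      simp [dotProduct, Pi.single_apply]
    have h2 : star w ⬝ᵥ (B *ᵥ w)
        = z * ((∑ i, ‖w i‖ ^ 2 : ℝ) : ℂ) - star w ⬝ᵥ (A.map Complex.ofReal *ᵥ w) := by
      rw [hB, Matrix.sub_mulVec, dotProduct_sub, Matrix.smul_mulVec, Matrix.one_mulVec,
        dotProduct_smul, smul_eq_mul]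
      congr 2
      rw [dotProduct, Complex.ofReal_sum]
      refine Finset.sum_congr rfl fun i _ => ?_
      rw [Pi.star_apply, RCLike.star_def, Complex.conj_mul']
      push_cast
      rfl
    have h3 : (star w ⬝ᵥ (A.map Complex.ofReal *ᵥ w)).im = 0 :=
      hAC.im_star_dotProduct_mulVec_self w
    calc z.im * ∑ i, ‖w i‖ ^ 2 = (star (w 0) * B.det).im := by
          rw [← h1, h2, Complex.sub_im, h3, Complex.im_mul_ofReal, sub_zero]
      _ ≤ ‖star (w 0) * B.det‖ := (le_abs_self _).trans (Complex.abs_im_le_norm _)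
      _ = ‖B.det‖ * ‖w 0‖ := by rw [norm_mul, norm_star, mul_comm]
  rw [← hcorner]
  have hsum : ∀ i, ‖w i‖ ^ 2 ≤ ∑ i, ‖w i‖ ^ 2 := fun i =>
    Finset.single_le_sum (f := fun i => ‖w i‖ ^ 2) (fun _ _ => sq_nonneg _) (Finset.mem_univ i)
  have h0 : z.im * ‖w 0‖ ^ 2 ≤ ‖B.det‖ * ‖w 0‖ :=
    (mul_le_mul_of_nonneg_left (hsum 0) hz.le).trans hquad
  have hl : z.im * ‖w (Fin.last n)‖ ^ 2 ≤ ‖B.det‖ * ‖w 0‖ :=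
    (mul_le_mul_of_nonneg_left (hsum _) hz.le).trans hquad
  have hd := norm_nonneg B.det
  rcases (norm_nonneg (w 0)).eq_or_lt with h | h
  · rw [← h, mul_zero] at hl
    have : ‖w (Fin.last n)‖ = 0 := by
      by_contra hne
      have := lt_of_le_of_ne (norm_nonneg (w (Fin.last n))) (Ne.symm hne)
      have : 0 < z.im * ‖w (Fin.last n)‖ ^ 2 := by positivity
      linarith
    rw [this, mul_zero]
    exact hd
  · have h1 : z.im * ‖w 0‖ ≤ ‖B.det‖ := by
      refine le_of_mul_le_mul_right ?_ h
      linarith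
    refine abs_le_of_sq_le_sq' ?_ hd |>.2
    nlinarith [mul_le_mul_of_nonneg_left h1 hd, mul_le_mul_of_nonneg_left hl hz.le]

/-- The Jacobi matrix with parameters `s k = (p_{k+1}, q_k)`, acting on all real sequences. -/
def jacobiEnd (s : ℕ → ℝ × ℝ) : Module.End ℝ (ℕ → ℝ) where
  toFun f l := (Nat.casesOn l 0 fun k => (s k).1 * f k) + (s l).2 * f l + (s l).1 * f (l + 1)
  map_add' f g := by
    ext l
    cases l <;> simp <;> ring
  map_smul' c f := by
    ext l
    cases l <;> simp <;> ring

theorem jacobiEnd_zero (s : ℕ → ℝ × ℝ) (f : ℕ → ℝ) :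
    jacobiEnd s f 0 = (s 0).2 * f 0 + (s 0).1 * f 1 := by
  simp [jacobiEnd]

theorem jacobiEnd_succ (s : ℕ → ℝ × ℝ) (f : ℕ → ℝ) (l : ℕ) :
    jacobiEnd s f (l + 1)
      = (s l).1 * f l + (s (l + 1)).2 * f (l + 1) + (s (l + 1)).1 * f (l + 2) := rfl

theorem abs_jacobiEnd_le {s : ℕ → ℝ × ℝ} {M : ℝ} (h1 : ∀ k, |(s k).1| ≤ M)
    (h2 : ∀ k, |(s k).2| ≤ M) {f : ℕ → ℝ} {B : ℝ} (hf : ∀ k, |f k| ≤ B) (l : ℕ) :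
    |jacobiEnd s f l| ≤ 3 * M * B := by
  have hmul : ∀ {x y : ℝ}, |x| ≤ M → |y| ≤ B → |x * y| ≤ M * B := fun hx hy => by
    rw [abs_mul]
    exact mul_le_mul hx hy (abs_nonneg _) ((abs_nonneg _).trans hx)
  have hMB : 0 ≤ M * B := (abs_nonneg _).trans (hmul (h1 0) (hf 0))
  cases l with
  | zero =>
    rw [jacobiEnd_zero]
    have := abs_add_le ((s 0).2 * f 0) ((s 0).1 * f 1)
    linarith [hmul (h2 0) (hf 0), hmul (h1 0) (hf 1)]
  | succ l =>
    rw [jacobiEnd_succ]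
    have := abs_add_three ((s l).1 * f l) ((s (l + 1)).2 * f (l + 1)) ((s (l + 1)).1 * f (l + 2))
    linarith [hmul (h1 l) (hf l), hmul (h2 (l + 1)) (hf (l + 1)), hmul (h1 (l + 1)) (hf (l + 2))]

theorem jacobiEnd_pow_succ_apply (s : ℕ → ℝ × ℝ) (k : ℕ) (f : ℕ → ℝ) :
    (jacobiEnd s ^ (k + 1)) f = jacobiEnd s ((jacobiEnd s ^ k) f) := by
  rw [pow_succ', Module.End.mul_apply]

theorem jacobiEnd_pow_single_eq_zero (s : ℕ → ℝ × ℝ) (c k : ℕ) :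
    ∀ l, c + k < l ∨ l + k < c → (jacobiEnd s ^ k) (Pi.single c 1) l = 0 := by
  induction k with
  | zero =>
    intro l hl
    rw [pow_zero, Module.End.one_apply, Pi.single_eq_of_ne (by omega)]
  | succ k ih =>
    intro l hl
    rw [jacobiEnd_pow_succ_apply]
    cases l with
    | zero => rw [jacobiEnd_zero, ih 0 (by omega), ih 1 (by omega), mul_zero, mul_zero, add_zero]
    | succ l =>
      rw [jacobiEnd_succ, ih l (by omega), ih (l + 1) (by omega), ih (l + 2) (by omega)]
      simp

theorem jacobiEnd_pow_single_shift (s t : ℕ → ℝ × ℝ) (c i k : ℕ) (hk : k ≤ c + 1)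
    (hst : ∀ l < c + k, t l = s (l + i)) :
    ∀ l, (jacobiEnd t ^ k) (Pi.single c 1) l = (jacobiEnd s ^ k) (Pi.single (c + i) 1) (l + i) := by
  induction k with
  | zero =>
    intro l
    simp only [pow_zero, Module.End.one_apply, Pi.single_apply, Nat.add_right_cancel_iff]
  | succ k ih =>
    intro l
    replace ih := ih (by omega) fun l hl => hst l (by omega)
    have hcoef : ∀ l', (jacobiEnd t ^ k) (Pi.single c 1) l' = 0 ∨ l' < c + k + 1 := by
      intro l'
      rcases Nat.lt_or_ge l' (c + k + 1) with h | h
      · exact Or.inr h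
      · exact Or.inl (jacobiEnd_pow_single_eq_zero t c k l' (Or.inl h))
    have hq : ∀ l', (t l').2 * (jacobiEnd t ^ k) (Pi.single c 1) l'
        = (s (l' + i)).2 * (jacobiEnd t ^ k) (Pi.single c 1) l' := by
      intro l'
      rcases hcoef l' with h | h
      · rw [h, mul_zero, mul_zero]
      · rw [hst l' (by omega)]
    have hp : ∀ l', (t l').1 * (jacobiEnd t ^ k) (Pi.single c 1) (l' + 1)
        = (s (l' + i)).1 * (jacobiEnd t ^ k) (Pi.single c 1) (l' + 1) := by
      intro l'
      rcases hcoef (l' + 1) with h | h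
      · rw [h, mul_zero, mul_zero]
      · rw [hst l' (by omega)]
    have hp' : ∀ l', (t l').1 * (jacobiEnd t ^ k) (Pi.single c 1) l'
        = (s (l' + i)).1 * (jacobiEnd t ^ k) (Pi.single c 1) l' := by
      intro l'
      rcases hcoef l' with h | h
      · rw [h, mul_zero, mul_zero]
      · rw [hst l' (by omega)]
    rw [jacobiEnd_pow_succ_apply, jacobiEnd_pow_succ_apply]
    cases l with
    | zero =>
      rw [jacobiEnd_zero, hq, hp, ih, ih]
      cases i with
      | zero => rw [Nat.add_zero, Nat.zero_add, jacobiEnd_zero]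
      | succ i =>
        rw [Nat.zero_add, jacobiEnd_succ,
          jacobiEnd_pow_single_eq_zero s (c + (i + 1)) k i (Or.inr (by omega)), mul_zero,
          show 0 + 1 + (i + 1) = i + 2 by omega, zero_add]
    | succ l =>
      rw [jacobiEnd_succ, hp', hq, hp, ih, ih, ih, show l + 1 + i = l + i + 1 by omega,
        show l + 2 + i = l + i + 2 by omega, jacobiEnd_succ]

theorem aeval_end_apply (T : Module.End ℝ (ℕ → ℝ)) (Φ : ℝ[X]) (f : ℕ → ℝ) (l : ℕ) :
    aeval T Φ f l = ∑ k ∈ Finset.range (Φ.natDegree + 1), Φ.coeff k * (T ^ k) f l := by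
  rw [aeval_eq_sum_range, LinearMap.sum_apply, Finset.sum_apply]
  rfl

theorem aeval_jacobiEnd_single_shift (s t : ℕ → ℝ × ℝ) {c : ℕ} (i : ℕ) {Φ : ℝ[X]}
    (hΦ : Φ.natDegree ≤ c + 1) (hst : ∀ l < c + Φ.natDegree, t l = s (l + i)) (l : ℕ) :
    aeval (jacobiEnd t) Φ (Pi.single c 1) l
      = aeval (jacobiEnd s) Φ (Pi.single (c + i) 1) (l + i) := by
  rw [aeval_end_apply, aeval_end_apply]
  refine Finset.sum_congr rfl fun k hk => ?_
  have hk' := Finset.mem_range.1 hk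
  rw [jacobiEnd_pow_single_shift s t c i k (by omega) fun l hl => hst l (by omega)]

theorem abs_sum_coeff_mul_le (Φ : ℝ[X]) {x : ℕ → ℝ} {R : ℝ} (hx : ∀ k, |x k| ≤ R ^ k) :
    |∑ k ∈ Finset.range (Φ.natDegree + 1), Φ.coeff k * x k|
      ≤ ∑ k ∈ Finset.range (Φ.natDegree + 1), |Φ.coeff k| * R ^ k := by
  refine (Finset.abs_sum_le_sum_abs _ _).trans (Finset.sum_le_sum fun k _ => ?_)
  rw [abs_mul]
  exact mul_le_mul_of_nonneg_left (hx k) (abs_nonneg _)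

theorem continuous_jacobiEnd_pow_apply {Y : Type*} [TopologicalSpace Y] {s : Y → ℕ → ℝ × ℝ}
    (hs : ∀ l, Continuous fun y => s y l) (f : ℕ → ℝ) (k : ℕ) :
    ∀ l, Continuous fun y => (jacobiEnd (s y) ^ k) f l := by
  induction k with
  | zero => exact fun l => continuous_const
  | succ k ih =>
    intro l
    simp only [jacobiEnd_pow_succ_apply]
    have h1 : ∀ l, Continuous fun y => (s y l).1 := fun l => continuous_fst.comp (hs l)
    have h2 : ∀ l, Continuous fun y => (s y l).2 := fun l => continuous_snd.comp (hs l)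
    cases l with
    | zero =>
      simp only [jacobiEnd_zero]
      exact ((h2 0).mul (ih 0)).add ((h1 0).mul (ih 1))
    | succ l =>
      simp only [jacobiEnd_succ]
      exact (((h1 l).mul (ih l)).add ((h2 _).mul (ih _))).add ((h1 _).mul (ih _))

/-- Extension of a finite block of parameters by zero. -/
def padZero {X : Type*} [Zero X] {n : ℕ} (v : Fin n → X) (l : ℕ) : X :=
  if h : l < n then v ⟨l, h⟩ else 0

theorem padZero_of_lt {X : Type*} [Zero X] {n : ℕ} (v : Fin n → X) {l : ℕ} (h : l < n) :
    padZero v l = v ⟨l, h⟩ :=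
  dif_pos h

theorem continuous_padZero (n l : ℕ) :
    Continuous fun v : Fin n → ℝ × ℝ => padZero v l := by
  by_cases h : l < n
  · simp only [padZero_of_lt _ h]
    exact continuous_apply _
  · simp only [padZero, dif_neg h]
    exact continuous_const

/-- The leading `n × n` block of a Jacobi matrix. -/
def jacobiBlock (s : ℕ → ℝ × ℝ) (n : ℕ) : Matrix (Fin n) (Fin n) ℝ :=
  Matrix.of fun i j => jacobiEnd s (Pi.single (j : ℕ) 1) i

theorem jacobiEnd_single_comm (s : ℕ → ℝ × ℝ) (i j : ℕ) :
    jacobiEnd s (Pi.single j 1) i = jacobiEnd s (Pi.single i 1) j := by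
  have h : ∀ l c : ℕ, jacobiEnd s (Pi.single c 1) l
      = if l = c then (s l).2 else if l = c + 1 then (s c).1 else
        if c = l + 1 then (s l).1 else 0 := by
    intro l c
    cases l with
    | zero =>
      rw [jacobiEnd_zero, Pi.single_apply, Pi.single_apply]
      split_ifs <;> first | contradiction | omega | simp
    | succ l =>
      rw [jacobiEnd_succ, Pi.single_apply, Pi.single_apply, Pi.single_apply]
      split_ifs <;> first | omega | (subst_vars; simp)
  rw [h, h]
  split_ifs <;> first | omega | (subst_vars; rfl)

theorem jacobiBlock_isHermitian (s : ℕ → ℝ × ℝ) (n : ℕ) : (jacobiBlock s n).IsHermitian := by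
  ext i j
  exact jacobiEnd_single_comm s j i

theorem jacobiBlock_eq_zero (s : ℕ → ℝ × ℝ) {n : ℕ} (i j : Fin n) (h : (j : ℕ) + 1 < i) :
    jacobiBlock s n i j = 0 := by
  have := jacobiEnd_pow_single_eq_zero s j 1 i (Or.inl h)
  rwa [pow_one] at this

theorem jacobiBlock_succ_castSucc (s : ℕ → ℝ × ℝ) {n : ℕ} (i : Fin n) :
    jacobiBlock s (n + 1) i.succ i.castSucc = (s i).1 := by
  simp [jacobiBlock, jacobiEnd_succ]

theorem jacobiBlock_mulVec (s : ℕ → ℝ × ℝ) {n : ℕ} (x : Fin n → ℝ) (i : Fin n) :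
    (jacobiBlock s n).mulVec x i = jacobiEnd s (padZero x) i := by
  have h : padZero x = ∑ j, x j • (Pi.single (j : ℕ) 1 : ℕ → ℝ) := by
    ext l
    simp only [Finset.sum_apply, Pi.smul_apply, smul_eq_mul, Pi.single_apply, mul_ite, mul_one,
      mul_zero]
    by_cases hl : l < n
    · rw [padZero_of_lt x hl, Finset.sum_eq_single ⟨l, hl⟩]
      · simp
      · intro j _ hj
        rw [if_neg]
        rintro rfl
        exact hj rfl
      · simp
    · rw [padZero, dif_neg hl, Finset.sum_eq_zero]
      intro j _
      rw [if_neg]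
      have := j.2
      omega
  rw [h, map_sum, Finset.sum_apply, Matrix.mulVec, dotProduct]
  refine Finset.sum_congr rfl fun j _ => ?_
  rw [map_smul, Pi.smul_apply, smul_eq_mul, mul_comm]
  rfl

theorem abs_jacobiBlock_mulVec_le {s : ℕ → ℝ × ℝ} {M : ℝ} (h1 : ∀ k, |(s k).1| ≤ M)
    (h2 : ∀ k, |(s k).2| ≤ M) {n : ℕ} {x : Fin n → ℝ} {B : ℝ} (hB : 0 ≤ B)
    (hx : ∀ k, |x k| ≤ B) (i : Fin n) : |(jacobiBlock s n).mulVec x i| ≤ 3 * M * B := by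
  rw [jacobiBlock_mulVec]
  refine abs_jacobiEnd_le h1 h2 (fun l => ?_) _
  rw [padZero]
  split_ifs
  · exact hx _
  · rwa [abs_zero]

theorem abs_jacobiBlock_pow_le {s : ℕ → ℝ × ℝ} {M : ℝ} (h1 : ∀ k, |(s k).1| ≤ M)
    (h2 : ∀ k, |(s k).2| ≤ M) {n : ℕ} (k : ℕ) :
    ∀ i j : Fin n, |(jacobiBlock s n ^ k) i j| ≤ (3 * M) ^ k := by
  have hM : 0 ≤ M := (abs_nonneg _).trans (h1 0)
  induction k with
  | zero =>
    intro i j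
    rw [pow_zero, pow_zero, Matrix.one_apply]
    split_ifs <;> simp
  | succ k ih =>
    intro i j
    rw [pow_succ', pow_succ']
    exact abs_jacobiBlock_mulVec_le h1 h2 (by positivity) (fun l => ih l j) i

theorem abs_eigenvalues_jacobiBlock_le {s : ℕ → ℝ × ℝ} {M : ℝ} (h1 : ∀ k, |(s k).1| ≤ M)
    (h2 : ∀ k, |(s k).2| ≤ M) {n : ℕ} (i : Fin n) :
    |(jacobiBlock_isHermitian s n).eigenvalues i| ≤ 3 * M := by
  set h := jacobiBlock_isHermitian s n
  set x : Fin n → ℝ := ⇑(h.eigenvectorBasis i) with hx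
  have hx0 : x ≠ 0 := fun h0 => by
    refine h.eigenvectorBasis.toBasis.ne_zero i ?_
    ext l
    simpa using! congrFun h0 l
  have hev : (jacobiBlock s n).mulVec x = h.eigenvalues i • x := h.mulVec_eigenvectorBasis i
  have : Nonempty (Fin n) := ⟨i⟩
  obtain ⟨j, hj⟩ := Finite.exists_max fun l => |x l|
  have hpos : 0 < |x j| := by
    refine lt_of_le_of_ne (abs_nonneg _) fun h0 => hx0 ?_
    ext l
    have := hj l
    rw [← h0] at this
    exact abs_eq_zero.1 (le_antisymm this (abs_nonneg _))
  have h3 := abs_jacobiBlock_mulVec_le h1 h2 hpos.le hj j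
  rw [hev, Pi.smul_apply, smul_eq_mul, abs_mul] at h3
  exact le_of_mul_le_mul_right h3 hpos

theorem jacobiBlock_pow_apply (s : ℕ → ℝ × ℝ) {n c : ℕ} (hc : c < n) (k : ℕ) (hk : c + k < n) :
    ∀ l : Fin n, (jacobiBlock s n ^ k) l ⟨c, hc⟩ = (jacobiEnd s ^ k) (Pi.single c 1) l := by
  induction k with
  | zero =>
    intro l
    rw [pow_zero, pow_zero, Module.End.one_apply, Matrix.one_apply, Pi.single_apply]
    simp [Fin.ext_iff]
  | succ k ih =>
    intro l
    replace ih := ih (by omega)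
    have h : padZero (fun l => (jacobiBlock s n ^ k) l ⟨c, hc⟩)
        = (jacobiEnd s ^ k) (Pi.single c 1) := by
      ext l
      rw [padZero]
      split_ifs with hl
      · rw [ih]
      · rw [jacobiEnd_pow_single_eq_zero s c k l (by omega)]
    rw [jacobiEnd_pow_succ_apply, ← h, ← jacobiBlock_mulVec, pow_succ']
    rfl

theorem aeval_matrix_apply {n : ℕ} (A : Matrix (Fin n) (Fin n) ℝ) (Φ : ℝ[X]) (i j : Fin n) :
    (aeval A Φ) i j = ∑ k ∈ Finset.range (Φ.natDegree + 1), Φ.coeff k * (A ^ k) i j := by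
  rw [aeval_eq_sum_range, Matrix.sum_apply]
  rfl

theorem integral_weight (m : ℕ) (α : ℕ → ℝ) :
    ∫ θ in (0 : ℝ)..2 * π,
      ((∑ n ∈ Finset.range (m + 1), C (α n) * Chebyshev.S ℝ n).eval (2 * Real.cos θ)
        * (4 * Real.sin θ ^ 2)) = 2 * π * (2 * α 0) := by
  have hterm : ∀ θ : ℝ, ((∑ n ∈ Finset.range (m + 1), C (α n) * Chebyshev.S ℝ n).eval
        (2 * Real.cos θ) * (4 * Real.sin θ ^ 2))
      = ∑ n ∈ Finset.range (m + 1), 2 * α n *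
        (Real.cos ((n : ℤ) * θ) - Real.cos (((n + 2 : ℕ) : ℤ) * θ)) := by
    intro θ
    simp only [eval_finsetSum, eval_mul, eval_C, Finset.sum_mul]
    refine Finset.sum_congr rfl fun n _ => ?_
    rw [mul_assoc (α n), S_two_mul_cos_mul_sin_sq]
    push_cast
    ring
  simp only [hterm]
  rw [intervalIntegral.integral_finsetSum
    fun i _ => Continuous.intervalIntegrable (by fun_prop) _ _]
  have hI : ∀ n : ℕ, ∫ θ in (0 : ℝ)..2 * π, 2 * α n *
        (Real.cos ((n : ℤ) * θ) - Real.cos (((n + 2 : ℕ) : ℤ) * θ))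
      = if n = 0 then 2 * π * (2 * α 0) else 0 := by
    intro n
    rw [intervalIntegral.integral_const_mul, intervalIntegral.integral_sub
      (Continuous.intervalIntegrable (by fun_prop) _ _)
      (Continuous.intervalIntegrable (by fun_prop) _ _), integral_cos_int_mul_two_pi,
      integral_cos_int_mul_two_pi, if_neg (by omega : ¬ ((n + 2 : ℕ) : ℤ) = 0)]
    split_ifs with h1 h2 h2
    · have : n = 0 := h2
      subst this
      ring
    · omega
    · omega
    · ring
  simp only [hI, Finset.sum_ite_eq', Finset.mem_range, Nat.succ_pos, if_true]

/-- The trace of the polynomial potential on large blocks is bounded below, up to an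
arbitrarily small linear error, by the logarithms of the off-diagonal entries. -/
theorem exists_trace_jacobiBlock_ge {m : ℕ} {α : ℕ → ℝ}
    (hA : ∀ x : ℝ, 0 ≤ (∑ n ∈ Finset.range (m + 1), C (α n) * Chebyshev.S ℝ n).eval x)
    (M : ℝ) {η : ℝ} (hη : 0 < η) :
    ∃ c : ℝ, ∀ s : ℕ → ℝ × ℝ, (∀ k, 0 < (s k).1) → (∀ k, |(s k).1| ≤ M) →
      (∀ k, |(s k).2| ≤ M) → ∀ n : ℕ,
        2 * α 0 * ∑ i ∈ Finset.range n, Real.log (s i).1 - η * (n + 1) - c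
          ≤ (aeval (jacobiBlock s (n + 1)) (potentialPoly m α)).trace := by
  obtain ⟨δ, hδ, hle⟩ := exists_integral_log_norm_le hA (3 * M) hη
  refine ⟨-(2 * α 0 * Real.log δ), fun s hpos h1 h2 n => ?_⟩
  set hJ := jacobiBlock_isHermitian s (n + 1)
  rw [trace_aeval_eq_sum_eigenvalues hJ]
  set W : ℝ → ℝ := fun θ =>
    (∑ n ∈ Finset.range (m + 1), C (α n) * Chebyshev.S ℝ n).eval (2 * Real.cos θ)
        * (4 * Real.sin θ ^ 2) with hW
  have hWc : Continuous W := by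
    refine ((Polynomial.continuous _).comp (by fun_prop)).mul (by fun_prop)
  have hW0 : ∀ θ, 0 ≤ W θ := fun θ => mul_nonneg (hA _) (by positivity)
  set z : ℝ → ℂ := fun θ => ((2 * Real.cos θ : ℝ) : ℂ) + δ * Complex.I with hz
  have hzim : ∀ θ, (z θ).im = δ := fun θ => by simp [hz, -Complex.ofReal_mul, -Complex.ofReal_cos]
  have hne : ∀ θ (l : ℝ), z θ - l ≠ 0 := fun θ l h => by
    have := congrArg Complex.im h
    rw [Complex.sub_im, hzim, Complex.ofReal_im, Complex.zero_im, sub_zero] at this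
    exact hδ.ne' this
  have hlc : ∀ l : ℝ, Continuous fun θ => Real.log ‖z θ - l‖ := fun l =>
    Continuous.log (by fun_prop) fun θ => norm_ne_zero_iff.2 (hne θ l)
  set P := ∑ i ∈ Finset.range n, Real.log (s i).1 with hP
  have hpt : ∀ θ, W θ * (Real.log δ + P)
      ≤ ∑ i, W θ * Real.log ‖z θ - (hJ.eigenvalues i : ℝ)‖ := by
    intro θ
    rw [← Finset.mul_sum]
    refine mul_le_mul_of_nonneg_left ?_ (hW0 θ)
    have hdet := mul_prod_le_norm_det hJ (fun i j h => jacobiBlock_eq_zero s i j h)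
      (z := z θ) (by rw [hzim]; exact hδ)
    rw [det_smul_one_sub_map_ofReal hJ, hzim, norm_prod] at hdet
    simp only [jacobiBlock_succ_castSucc] at hdet
    rw [Fin.prod_univ_eq_prod_range (fun i => |(s i).1|) n] at hdet
    rw [hP, ← Real.log_prod fun i _ => norm_ne_zero_iff.2 (hne θ _),
      ← Real.log_prod fun i _ => (hpos i).ne', ← Real.log_mul hδ.ne'
      (Finset.prod_ne_zero_iff.2 fun i _ => (hpos i).ne')]
    refine Real.log_le_log (mul_pos hδ (Finset.prod_pos fun i _ => hpos i)) ?_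
    simpa only [abs_of_pos (hpos _)] using hdet
  have hI : ∫ θ in (0 : ℝ)..2 * π, W θ * (Real.log δ + P)
      ≤ ∑ i, ∫ θ in (0 : ℝ)..2 * π, W θ * Real.log ‖z θ - (hJ.eigenvalues i : ℝ)‖ := by
    have hi : ∀ l : ℝ, Continuous fun θ => W θ * Real.log ‖z θ - l‖ := fun l => hWc.mul (hlc l)
    rw [← intervalIntegral.integral_finsetSum fun i _ => (hi _).intervalIntegrable _ _]
    refine intervalIntegral.integral_mono_on (by positivity)
      ((hWc.mul continuous_const).intervalIntegrable _ _)
      ((continuous_finsetSum _ fun i _ => hi _).intervalIntegrable _ _)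
      fun θ _ => hpt θ
  rw [intervalIntegral.integral_mul_const, hW, integral_weight] at hI
  have hsum := hI.trans (Finset.sum_le_sum fun i _ =>
    hle _ (abs_eigenvalues_jacobiBlock_le h1 h2 i))
  rw [← Finset.mul_sum, mul_assoc] at hsum
  have hfin := le_of_mul_le_mul_left hsum (by positivity)
  rw [Finset.sum_add_distrib, Finset.sum_const, Finset.card_univ, Fintype.card_fin, nsmul_eq_mul]
    at hfin
  push_cast at hfin
  linarith

/-- The indicator of `i - 1`, with value `0` at `i = 0`. -/
def predSingle (i : ℕ) : ℕ → ℝ :=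
  Nat.casesOn i 0 fun j => Pi.single j 1

theorem jacobiEnd_free_predSingle (i : ℕ) :
    jacobiEnd (fun _ => (1, 0)) (predSingle (i + 1)) = predSingle (i + 2) + predSingle i := by
  ext l
  rw [Pi.add_apply]
  cases i with
  | zero =>
    cases l with
    | zero => simp [jacobiEnd_zero, predSingle]
    | succ l => simp [jacobiEnd_succ, predSingle, Pi.single_apply]
  | succ i =>
    cases l with
    | zero => simp [jacobiEnd_zero, predSingle, Pi.single_apply, eq_comm]
    | succ l =>
      simp only [jacobiEnd_succ, predSingle, Pi.single_apply]
      split_ifs <;> first | omega | simp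

theorem aeval_free_chebyshev_C_predSingle {b : ℕ} :
    ∀ k : ℕ, k ≤ b → 1 ≤ b → aeval (jacobiEnd fun _ => (1, 0)) (Chebyshev.C ℝ k) (predSingle b)
      = predSingle (b + k) + predSingle (b - k) := by
  intro k
  induction k using Nat.twoStepInduction with
  | zero =>
    intro _ _
    simp [← one_add_one_eq_two]
  | one =>
    intro _ h
    obtain ⟨b, rfl⟩ := Nat.exists_eq_add_of_le' h
    simp [jacobiEnd_free_predSingle]
  | more k ih0 ih1 =>
    intro h hb
    have hC := Chebyshev.C_add_two ℝ k
    push_cast at hC ih1 ⊢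
    rw [hC, map_sub, map_mul, aeval_X, LinearMap.sub_apply, Module.End.mul_apply,
      ih1 (by omega) hb, ih0 (by omega) hb, map_add]
    obtain ⟨j, hj⟩ := Nat.exists_eq_add_of_le' (by omega : k + 2 ≤ b)
    rw [show b + (k + 1) = b + k + 1 by ring, jacobiEnd_free_predSingle,
      show b - (k + 1) = j + 1 by omega, jacobiEnd_free_predSingle, show b - k = j + 2 by omega,
      show b - (k + 2) = j by omega, show b + (k + 2) = b + k + 2 by ring]
    abel

theorem aeval_free_potentialPoly (m : ℕ) (α : ℕ → ℝ) :
    aeval (jacobiEnd fun _ => (1, 0)) (potentialPoly m α) (Pi.single (m + 1) 1) (m + 1) = 0 := by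
  have hC : ∀ k : ℕ, k ≤ m + 2 → k ≠ 0 →
      aeval (jacobiEnd fun _ => (1, 0)) (Chebyshev.C ℝ k) (Pi.single (m + 1) 1) (m + 1) = 0 := by
    intro k hk hk0
    have h := congrFun (aeval_free_chebyshev_C_predSingle (b := m + 2) k hk (by omega)) (m + 1)
    have h1 : predSingle (m + 2 + k) (m + 1) = 0 := by
      rw [show m + 2 + k = m + 1 + k + 1 by ring]
      exact Pi.single_eq_of_ne (by omega) _
    have h2 : predSingle (m + 2 - k) (m + 1) = 0 := by
      rcases hj : m + 2 - k with _ | j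
      · rfl
      · exact Pi.single_eq_of_ne (by omega) _
    rw [Pi.add_apply, h1, h2, add_zero] at h
    exact h
  rw [potentialPoly, map_sum, LinearMap.sum_apply, Finset.sum_apply]
  refine Finset.sum_eq_zero fun n hn => ?_
  have hn' := Finset.mem_range.1 hn
  rw [← smul_eq_C_mul, map_smul, LinearMap.smul_apply, Pi.smul_apply, map_sub, LinearMap.sub_apply,
    Pi.sub_apply, ← smul_eq_C_mul, ← smul_eq_C_mul, map_smul, map_smul, LinearMap.smul_apply,
    LinearMap.smul_apply, Pi.smul_apply, Pi.smul_apply, hC (n + 2) (by omega) (by omega)]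
  rcases Nat.eq_zero_or_pos n with rfl | h
  · simp
  · rw [hC n (by omega) h.ne']
    simp

theorem abs_sum_range_sub_le {F : ℕ → ℝ} {B : ℝ} (hF : ∀ i, |F i| ≤ B) (u L w : ℕ) :
    |∑ i ∈ Finset.range (u + L + w), F i - ∑ i ∈ Finset.range L, F (u + i)| ≤ (u + w) * B := by
  rw [Finset.sum_range_add, Finset.sum_range_add]
  have h : ∀ (n : ℕ) (G : ℕ → ℝ), (∀ i, |G i| ≤ B) → |∑ i ∈ Finset.range n, G i| ≤ n * B := by
    intro n G hG
    refine (Finset.abs_sum_le_sum_abs _ _).trans ((Finset.sum_le_sum fun i _ => hG i).trans ?_)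
    simp
  rw [show ∀ x y z : ℝ, x + y + z - y = x + z by intros; ring]
  refine (abs_add_le _ _).trans ?_
  rw [add_mul]
  exact add_le_add (h u _ hF) (h w _ fun i => hF _)

/-- The functional `h_A` of a block of parameters, with the contribution of the free Jacobi
matrix replaced by the constant `c`. -/
def blockFunctional (m : ℕ) (a c : ℝ) (Φ : ℝ[X]) (v : Fin (2 * m + 4) → ℝ × ℝ) : ℝ :=
  -a * Real.log (v ⟨m + 1, by omega⟩).1
    + (aeval (jacobiEnd (padZero v)) Φ (Pi.single (m + 1) 1) (m + 1) - c)

theorem blockFunctional_window {m : ℕ} {a c : ℝ} {Φ : ℝ[X]} (hΦ : Φ.natDegree ≤ m + 2)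
    (s : ℕ → ℝ × ℝ) (i : ℕ) :
    blockFunctional m a c Φ (fun j => s (i + j))
      = -a * Real.log (s (m + 1 + i)).1
        + (aeval (jacobiEnd s) Φ (Pi.single (m + 1 + i) 1) (m + 1 + i) - c) := by
  rw [blockFunctional, aeval_jacobiEnd_single_shift s _ i hΦ]
  · simp only [add_comm i]
  · intro l hl
    rw [padZero_of_lt _ (by omega : l < 2 * m + 4), add_comm]

theorem continuousOn_blockFunctional (m : ℕ) (a c : ℝ) (Φ : ℝ[X]) {K : Set (ℝ × ℝ)}
    (hK : ∀ x ∈ K, 0 < x.1) : ContinuousOn (blockFunctional m a c Φ) {v | ∀ i, v i ∈ K} := by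
  unfold blockFunctional
  simp only [aeval_end_apply]
  refine ContinuousOn.add (continuousOn_const.mul (ContinuousOn.log
    (continuous_fst.comp (continuous_apply _)).continuousOn fun v hv => (hK _ (hv _)).ne'))
    (Continuous.continuousOn ((continuous_finsetSum _ fun k _ => continuous_const.mul ?_).sub
      continuous_const))
  exact continuous_jacobiEnd_pow_apply (fun l => continuous_padZero _ l) _ k _

theorem exists_sum_blockFunctional_ge {m : ℕ} {α : ℕ → ℝ}
    (hA : ∀ x : ℝ, 0 ≤ (∑ n ∈ Finset.range (m + 1), C (α n) * Chebyshev.S ℝ n).eval x)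
    {c : ℝ} {Φ : ℝ[X]} (hdeg : Φ.natDegree ≤ m + 2) (hΦ : Φ = C c + potentialPoly m α)
    {ε M : ℝ} (hε : 0 < ε) {η : ℝ} (hη : 0 < η) :
    ∃ C : ℝ, ∀ s : ℕ → ℝ × ℝ, (∀ i, s i ∈ Set.Icc ε M ×ˢ Set.Icc (-M) M) → ∀ L : ℕ,
      -(η * L) - C ≤ ∑ i ∈ Finset.range L,
        blockFunctional m (2 * α 0) c Φ (fun j => s (i + j)) := by
  obtain ⟨C₁, hC₁⟩ := exists_trace_jacobiBlock_ge hA M hη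
  set B := ∑ k ∈ Finset.range (Φ.natDegree + 1), |Φ.coeff k| * (3 * M) ^ k with hB
  set Λ := max |Real.log ε| |Real.log M| with hΛ
  refine ⟨C₁ + η * (2 * m + 4) - (2 * m + 4) * c + (2 * m + 4) * B
    + |2 * α 0| * ((2 * m + 3) * Λ), fun s hs L => ?_⟩
  have hp : ∀ k, ε ≤ (s k).1 ∧ (s k).1 ≤ M := fun k => (hs k).1
  have hp0 : ∀ k, 0 < (s k).1 := fun k => hε.trans_le (hp k).1
  have h1 : ∀ k, |(s k).1| ≤ M := fun k => by
    rw [abs_of_pos (hp0 k)]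
    exact (hp k).2
  have h2 : ∀ k, |(s k).2| ≤ M := fun k => abs_le.2 (hs k).2
  have hlog : ∀ k, |Real.log (s k).1| ≤ Λ := fun k =>
    abs_le_max_abs_abs (Real.log_le_log hε (hp k).1) (Real.log_le_log (hp0 k) (hp k).2)
  have htr := hC₁ s hp0 h1 h2 (m + 1 + L + (m + 2))
  set J := jacobiBlock s (m + 1 + L + (m + 2) + 1) with hJ
  set D : ℕ → ℝ := fun k => if h : k < m + 1 + L + (m + 2) + 1 then (aeval J Φ) ⟨k, h⟩ ⟨k, h⟩ else 0
    with hD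
  have hB0 : ∀ k, |D k| ≤ B := by
    intro k
    simp only [hD]
    split_ifs with h
    · rw [aeval_matrix_apply]
      exact abs_sum_coeff_mul_le Φ fun k => abs_jacobiBlock_pow_le h1 h2 k _ _
    · have hM : 0 ≤ M := (abs_nonneg _).trans (h1 0)
      rw [abs_zero, hB]
      exact Finset.sum_nonneg fun k _ => by positivity
  have htrace : (aeval J Φ).trace = ∑ k ∈ Finset.range (m + 1 + L + (m + 2) + 1), D k := by
    rw [← Fin.sum_univ_eq_sum_range, Matrix.trace]
    refine Finset.sum_congr rfl fun i _ => ?_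
    simp only [hD, dif_pos i.2, Matrix.diag_apply]
  have htrace' : (aeval J Φ).trace
      = (m + 1 + L + (m + 2) + 1) * c + (aeval J (potentialPoly m α)).trace := by
    rw [hΦ, map_add, aeval_C, Matrix.trace_add, Algebra.algebraMap_eq_smul_one, Matrix.trace_smul,
      Matrix.trace_one]
    simp
    ring
  have hDi : ∀ i ∈ Finset.range L,
      aeval (jacobiEnd s) Φ (Pi.single (m + 1 + i) 1) (m + 1 + i) = D (m + 1 + i) := by
    intro i hi
    have hi' := Finset.mem_range.1 hi
    simp only [hD]
    rw [dif_pos (by omega), aeval_matrix_apply, aeval_end_apply]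
    refine Finset.sum_congr rfl fun k hk => ?_
    have hk' := Finset.mem_range.1 hk
    rw [jacobiBlock_pow_apply s _ k (by omega)]
  have hsum : ∑ i ∈ Finset.range L, blockFunctional m (2 * α 0) c Φ (fun j => s (i + j))
      = -(2 * α 0) * ∑ i ∈ Finset.range L, Real.log (s (m + 1 + i)).1
        + (∑ i ∈ Finset.range L, D (m + 1 + i) - L * c) := by
    simp only [blockFunctional_window hdeg]
    rw [Finset.sum_add_distrib, Finset.sum_sub_distrib, Finset.sum_congr rfl hDi, Finset.mul_sum]
    simp
  have hDb := abs_le.1 (abs_sum_range_sub_le hB0 (m + 1) L (m + 3))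
  have hLb := mul_le_mul_of_nonneg_left (abs_sum_range_sub_le hlog (m + 1) L (m + 2))
    (abs_nonneg (2 * α 0))
  rw [← abs_mul] at hLb
  have hLb' := abs_le.1 hLb
  rw [hsum]
  rw [htrace] at htrace'
  rw [show m + 1 + L + (m + 3) = m + 1 + L + (m + 2) + 1 by ring] at hDb
  push_cast at htr hDb hLb'
  linarith [hLb'.1, hLb'.2, hDb.1, hDb.2]

theorem coe_e (k : ℕ) : ⇑(e k) = Pi.single k 1 :=
  lp.coeFn_single 2 k 1

theorem jacobiEnd_zero_single (s : ℕ → ℝ × ℝ) :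
    jacobiEnd s (Pi.single 0 1)
      = (s 0).2 • (Pi.single 0 1 : ℕ → ℝ) + (s 0).1 • (Pi.single 1 1 : ℕ → ℝ) := by
  ext l
  cases l with
  | zero => simp [jacobiEnd_zero]
  | succ l =>
    simp only [jacobiEnd_succ, Pi.add_apply, Pi.smul_apply, smul_eq_mul, Pi.single_apply]
    grind

theorem jacobiEnd_succ_single (s : ℕ → ℝ × ℝ) (k : ℕ) :
    jacobiEnd s (Pi.single (k + 1) 1)
      = (s k).1 • (Pi.single k 1 : ℕ → ℝ) + (s (k + 1)).2 • (Pi.single (k + 1) 1 : ℕ → ℝ)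
        + (s (k + 1)).1 • (Pi.single (k + 2) 1 : ℕ → ℝ) := by
  ext l
  cases l with
  | zero =>
    simp only [jacobiEnd_zero, Pi.add_apply, Pi.smul_apply, smul_eq_mul, Pi.single_apply]
    grind
  | succ l =>
    simp only [jacobiEnd_succ, Pi.add_apply, Pi.smul_apply, smul_eq_mul, Pi.single_apply]
    grind

section

variable {s : ℕ → ℝ × ℝ} {J : H →L[ℝ] H}

theorem coe_jacobi_apply (h0 : J (e 0) = (s 0).2 • e 0 + (s 0).1 • e 1)
    (hs : ∀ k, J (e (k + 1))
      = (s k).1 • e k + (s (k + 1)).2 • e (k + 1) + (s (k + 1)).1 • e (k + 2))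
    {x : H} (hx : x ∈ Submodule.span ℝ (Set.range e)) :
    J x ∈ Submodule.span ℝ (Set.range e) ∧ ⇑(J x) = jacobiEnd s x := by
  have he : ∀ k, e k ∈ Submodule.span ℝ (Set.range e) := fun k => Submodule.subset_span ⟨k, rfl⟩
  induction hx using Submodule.span_induction with
  | mem x hx =>
    obtain ⟨k, rfl⟩ := hx
    cases k with
    | zero =>
      rw [h0]
      refine ⟨add_mem (Submodule.smul_mem _ _ (he _)) (Submodule.smul_mem _ _ (he _)), ?_⟩
      rw [lp.coeFn_add, lp.coeFn_smul, lp.coeFn_smul, coe_e, coe_e, jacobiEnd_zero_single]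
    | succ k =>
      rw [hs]
      refine ⟨add_mem (add_mem (Submodule.smul_mem _ _ (he _)) (Submodule.smul_mem _ _ (he _)))
        (Submodule.smul_mem _ _ (he _)), ?_⟩
      rw [lp.coeFn_add, lp.coeFn_add, lp.coeFn_smul, lp.coeFn_smul, lp.coeFn_smul, coe_e, coe_e,
        coe_e, jacobiEnd_succ_single]
  | zero => exact ⟨by rw [map_zero]; exact zero_mem _, by rw [map_zero, lp.coeFn_zero, map_zero]⟩
  | add x y _ _ hx hy =>
    rw [map_add]
    exact ⟨add_mem hx.1 hy.1, by rw [lp.coeFn_add, lp.coeFn_add, hx.2, hy.2, map_add]⟩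
  | smul c x _ hx =>
    rw [map_smul]
    exact ⟨Submodule.smul_mem _ _ hx.1, by rw [lp.coeFn_smul, lp.coeFn_smul, hx.2, map_smul]⟩

theorem coe_jacobi_pow_apply (h0 : J (e 0) = (s 0).2 • e 0 + (s 0).1 • e 1)
    (hs : ∀ k, J (e (k + 1))
      = (s k).1 • e k + (s (k + 1)).2 • e (k + 1) + (s (k + 1)).1 • e (k + 2)) (c k : ℕ) :
    (J ^ k) (e c) ∈ Submodule.span ℝ (Set.range e)
      ∧ ⇑((J ^ k) (e c)) = (jacobiEnd s ^ k) (Pi.single c 1) := by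
  induction k with
  | zero => exact ⟨Submodule.subset_span ⟨c, rfl⟩, coe_e c⟩
  | succ k ih =>
    have h := coe_jacobi_apply h0 hs ih.1
    rw [pow_succ', mul_apply_eq_comp, jacobiEnd_pow_succ_apply, ← ih.2]
    exact h

theorem inner_aeval_jacobi (h0 : J (e 0) = (s 0).2 • e 0 + (s 0).1 • e 1)
    (hs : ∀ k, J (e (k + 1))
      = (s k).1 • e k + (s (k + 1)).2 • e (k + 1) + (s (k + 1)).1 • e (k + 2))
    (Φ : ℝ[X]) (c : ℕ) :
    ⟪aeval J Φ (e c), e c⟫ = aeval (jacobiEnd s) Φ (Pi.single c 1) c := by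
  have hin : ∀ y : H, ⟪y, e c⟫ = y c := fun y => by
    rw [e, lp.inner_single_right]
    simp
  rw [aeval_eq_sum_range, sum_apply, sum_inner, aeval_end_apply]
  refine Finset.sum_congr rfl fun k _ => ?_
  rw [smul_apply, real_inner_smul_left, hin, (coe_jacobi_pow_apply h0 hs c k).2]

end

theorem isCompact_setOf_forall_mem {X ι : Type*} [TopologicalSpace X] {K : Set X}
    (hK : IsCompact K) : IsCompact {v : ι → X | ∀ i, v i ∈ K} := by
  simpa [Set.pi] using isCompact_univ_pi fun _ : ι => hK

/-- There are continuous `g ≥ 0` on `K^N` and `γ` on `K^{N-1}` (`N = 2m+4`,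
`K = [ε,M] × [-M,M]`) with
`h_A(J) = g(v₁,…,v_N) + γ(v₂,…,v_N) - γ(v₁,…,v_{N-1})`, `v_j = (p_j, q_{j-1})`,
for every Jacobi matrix `J` with coefficients in the prescribed box. -/
theorem stmt_16
    (A : Polynomial ℝ) (m : ℕ) (hdeg : A.natDegree = m) (hA : ∀ x : ℝ, 0 ≤ A.eval x)
    (a : ℝ) (ha : a = (1 / π) * ∫ x in (-2 : ℝ)..2, A.eval x * Real.sqrt (4 - x ^ 2))
    (Φ : Polynomial ℝ) (hΦdeg : Φ.natDegree = m + 2)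
    (hΦ : ∀ z : ℝ, (derivative Φ).eval z
      = z * A.eval z
        - (1 / π) * ∫ x in (-2 : ℝ)..2,
            ((A.eval x - A.eval z) / (x - z)) * Real.sqrt (4 - x ^ 2))
    (ε M : ℝ) (hε : 0 < ε) (hε1 : ε ≤ 1) (hM : 1 ≤ M) :
    ∃ g : (Fin (2 * m + 4) → ℝ × ℝ) → ℝ, ∃ γ : (Fin (2 * m + 3) → ℝ × ℝ) → ℝ,
      ContinuousOn g {v | ∀ i, v i ∈ Set.Icc ε M ×ˢ Set.Icc (-M) M}
      ∧ ContinuousOn γ {v | ∀ i, v i ∈ Set.Icc ε M ×ˢ Set.Icc (-M) M}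
      ∧ (∀ v : Fin (2 * m + 4) → ℝ × ℝ,
          (∀ i, v i ∈ Set.Icc ε M ×ˢ Set.Icc (-M) M) → 0 ≤ g v)
      ∧ ∀ (p q : ℕ → ℝ) (J J₀ : H →L[ℝ] H),
          (∀ k : ℕ, 1 ≤ k → p k ∈ Set.Icc ε M) → (∀ k : ℕ, q k ∈ Set.Icc (-M) M) →
          J (e 0) = q 0 • e 0 + p 1 • e 1 →
          (∀ k, 1 ≤ k → J (e k) = p k • e (k - 1) + q k • e k + p (k + 1) • e (k + 1)) →
          J₀ (e 0) = e 1 →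
          (∀ k, 1 ≤ k → J₀ (e k) = e (k - 1) + e (k + 1)) →
          -a * Real.log (p (m + 2)) + ⟪(aeval J Φ - aeval J₀ Φ) (e (m + 1)), e (m + 1)⟫
            = g (fun i => (p ((i : ℕ) + 1), q (i : ℕ)))
              + γ (fun j => (p ((j : ℕ) + 2), q ((j : ℕ) + 1)))
              - γ (fun j => (p ((j : ℕ) + 1), q (j : ℕ))) := by
  obtain ⟨α, rfl⟩ := exists_eq_sum_S m A hdeg.le
  rw [integral_sum_S_mul_sqrt] at ha
  subst ha
  have hΦα := derivative_eq_of_secondary m α Φ hΦ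
  set c := (Φ - potentialPoly m α).coeff 0
  have hK : IsCompact (Set.Icc ε M ×ˢ Set.Icc (-M) M) := isCompact_Icc.prod isCompact_Icc
  have hcont := continuousOn_blockFunctional m (2 * α 0) c Φ
    (K := Set.Icc ε M ×ˢ Set.Icc (-M) M) fun x hx => hε.trans_le hx.1.1
  obtain ⟨B, hB⟩ := (isCompact_setOf_forall_mem hK).bddAbove_image hcont
  obtain ⟨g, γ, hg, hγ, hg0, hgγ⟩ := exists_nonneg_add_coboundary hK (2 * m + 3)
    (blockFunctional m (2 * α 0) c Φ) hcont
    (exists_le_windowSum_of_linear_error (2 * m + 3) (blockFunctional m (2 * α 0) c Φ) B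
      (fun v hv => hB ⟨v, hv, rfl⟩)
      fun η hη => exists_sum_blockFunctional_ge hA hΦdeg.le hΦα hε hη)
  refine ⟨g, γ, hg, hγ, hg0, fun p q J J₀ _ _ hJ0 hJ hJ₀0 hJ₀ => ?_⟩
  have hfree : ⟪aeval J₀ Φ (e (m + 1)), e (m + 1)⟫ = c := by
    rw [inner_aeval_jacobi (s := fun _ => (1, 0)) (by simpa using hJ₀0)
      (fun k => by simpa using hJ₀ (k + 1) k.succ_pos), hΦα, map_add, LinearMap.add_apply,
      Pi.add_apply, aeval_free_potentialPoly, aeval_C]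
    simp
  have hblock := blockFunctional_window (a := 2 * α 0) (c := c) hΦdeg.le
    (fun i => (p (i + 1), q i)) 0
  rw [sub_apply, inner_sub_left, hfree,
    inner_aeval_jacobi (s := fun i => (p (i + 1), q i)) hJ0
      (fun k => by simpa using hJ (k + 1) k.succ_pos)]
  simp only [zero_add, add_zero] at hblock
  exact hblock.symm.trans (hgγ _)

end
end

section
/- For integers m > n ≥ 1 and A = U_m·U_n one has a_A = 0 and tr( Φ_A(J) − Φ_A(J₀) ) = (1/(m+n))·tr( T_{m+n}(J) − T_{m+n}(J₀) ) − (1/(m−n))·tr( T_{m−n}(J) − T_{m−n}(J₀) ); and for m = n ≥ 1 and A = U_n² one has a_A = 2 and tr( Φ_A(J) − Φ_A(J₀) ) = (1/(2n))·tr( T_{2n}(J) − T_{2n}(J₀) ). -/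
open Polynomial
open scoped ENNReal RealInnerProductSpace Real

noncomputable section

/-- Chebyshev polynomials of the second kind normalized to `[-2,2]`. -/
def U : ℕ → Polynomial ℝ
  | 0 => 0
  | 1 => 1
  | (n + 2) => Polynomial.X * U (n + 1) - U n

lemma U_add_two (n : ℕ) : U (n + 2) = X * U (n + 1) - U n := rfl

lemma T_add_two (n : ℕ) : T (n + 2) = X * T (n + 1) - T n := rfl

lemma T_add_one_eq (n : ℕ) : T (n + 1) = U (n + 2) - U n := by
  induction n using Nat.twoStepInduction with
  | zero => simp [T, U]
  | one =>
    simp only [T, U, map_ofNat]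
    ring
  | more n h₁ h₂ =>
    rw [T_add_two (n + 1), h₂, h₁, U_add_two (n + 2), U_add_two n]
    ring

lemma derivative_T (n : ℕ) : derivative (T n) = (n : ℝ[X]) * U n := by
  induction n using Nat.twoStepInduction with
  | zero => simp [T, U]
  | one => simp [T, U]
  | more n h₁ h₂ =>
    rw [T_add_two, derivative_sub, derivative_mul, derivative_X, h₁, h₂, T_add_one_eq,
      U_add_two]
    push_cast
    ring

lemma U_succ_mul_U_succ (a b : ℕ) : U (a + 1) * U (b + 1) = U a * U b + U (a + b + 1) := by
  induction b using Nat.twoStepInduction with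
  | zero => simp [U]
  | one =>
    simp only [U]
    ring
  | more b h₁ h₂ =>
    have h := U_add_two (a + b + 1)
    rw [show a + (b + 2) + 1 = a + b + 1 + 2 by ring, h, U_add_two (b + 1)]
    have hb := U_add_two b
    rw [show a + (b + 1) + 1 = a + b + 1 + 1 by ring] at h₂
    linear_combination X * h₂ - h₁ - U a * hb

lemma U_eval_two_mul_cos_mul_sin (n : ℕ) (θ : ℝ) :
    (U n).eval (2 * Real.cos θ) * Real.sin θ = Real.sin (n * θ) := by
  induction n using Nat.twoStepInduction with
  | zero => simp [U]
  | one => simp [U]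
  | more n h₁ h₂ =>
    rw [U_add_two, eval_sub, eval_mul, eval_X, sub_mul, mul_assoc, h₁, h₂]
    have e₁ : ((n + 2 : ℕ) : ℝ) * θ = (n + 1 : ℕ) * θ + θ := by push_cast; ring
    have e₂ : (n : ℝ) * θ = (n + 1 : ℕ) * θ - θ := by push_cast; ring
    rw [e₁, e₂, Real.sin_add, Real.sin_sub]
    ring

/-- Integration of a polynomial against the semicircle weight `√(4 - x²) / π` on `[-2, 2]`. -/
def semicircleIntegral : ℝ[X] →ₗ[ℝ] ℝ where
  toFun A := (1 / π) * ∫ x in (-2 : ℝ)..2, A.eval x * Real.sqrt (4 - x ^ 2)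
  map_add' A B := by
    rw [← mul_add, ← intervalIntegral.integral_add]
    · simp only [eval_add, add_mul]
    all_goals exact Continuous.intervalIntegrable (by fun_prop) _ _
  map_smul' c A := by
    simp only [eval_smul, smul_eq_mul, mul_assoc, intervalIntegral.integral_const_mul,
      RingHom.id_apply]
    ring

lemma semicircleIntegral_apply (A : ℝ[X]) :
    semicircleIntegral A
      = (1 / π) * ∫ x in (-2 : ℝ)..2, A.eval x * Real.sqrt (4 - x ^ 2) := rfl

lemma integral_mul_semicircle_eq_integral_cos (A : ℝ[X]) :
    ∫ x in (-2 : ℝ)..2, A.eval x * Real.sqrt (4 - x ^ 2)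
      = ∫ θ in (0 : ℝ)..π, A.eval (2 * Real.cos θ) * (4 * Real.sin θ ^ 2) := by
  have h := intervalIntegral.integral_comp_mul_deriv (a := 0) (b := π)
    (f := fun θ => 2 * Real.cos θ) (f' := fun θ => 2 * -Real.sin θ)
    (g := fun x => A.eval x * Real.sqrt (4 - x ^ 2))
    (fun θ _ => (Real.hasDerivAt_cos θ).const_mul 2) (by fun_prop) (by fun_prop)
  simp only [Real.cos_zero, Real.cos_pi, mul_one, mul_neg] at h
  rw [intervalIntegral.integral_symm, ← h, ← intervalIntegral.integral_neg]
  refine intervalIntegral.integral_congr fun θ hθ => ?_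
  rw [Set.uIcc_of_le Real.pi_pos.le] at hθ
  have hs : Real.sqrt (4 - (2 * Real.cos θ) ^ 2) = 2 * Real.sin θ := by
    rw [show 4 - (2 * Real.cos θ) ^ 2 = (2 * Real.sin θ) ^ 2 by
      rw [mul_pow, mul_pow, Real.sin_sq]; ring]
    exact Real.sqrt_sq (mul_nonneg zero_le_two (Real.sin_nonneg_of_mem_Icc hθ))
  simp only [Function.comp_apply, hs]
  ring

lemma integral_cos_nat_mul_s17 {k : ℕ} (hk : k ≠ 0) :
    ∫ θ in (0 : ℝ)..π, Real.cos (k * θ) = 0 := by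
  have hk' : (k : ℝ) ≠ 0 := Nat.cast_ne_zero.mpr hk
  rw [intervalIntegral.integral_comp_mul_left (fun θ => Real.cos θ) hk', integral_cos]
  simp [Real.sin_nat_mul_pi]

lemma semicircleIntegral_U_succ (k : ℕ) :
    semicircleIntegral (U (k + 1)) = if k = 0 then 2 else 0 := by
  have h : ∫ θ in (0 : ℝ)..π, (U (k + 1)).eval (2 * Real.cos θ) * (4 * Real.sin θ ^ 2)
      = ∫ θ in (0 : ℝ)..π, 2 * (Real.cos (k * θ) - Real.cos ((k + 2 : ℕ) * θ)) := by
    refine intervalIntegral.integral_congr fun θ _ => ?_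
    have e₁ : ((k + 2 : ℕ) : ℝ) * θ = (k + 1 : ℕ) * θ + θ := by push_cast; ring
    have e₂ : (k : ℝ) * θ = (k + 1 : ℕ) * θ - θ := by push_cast; ring
    simp only [e₁, e₂, Real.cos_add, Real.cos_sub]
    linear_combination (4 * Real.sin θ) * U_eval_two_mul_cos_mul_sin (k + 1) θ
  rw [semicircleIntegral_apply, integral_mul_semicircle_eq_integral_cos, h,
    intervalIntegral.integral_const_mul, intervalIntegral.integral_sub
      (Continuous.intervalIntegrable (by fun_prop) _ _)
      (Continuous.intervalIntegrable (by fun_prop) _ _),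
    integral_cos_nat_mul_s17 (Nat.succ_ne_zero _)]
  split_ifs with hk
  · subst hk
    have := Real.pi_ne_zero
    simp
    field_simp
  · rw [integral_cos_nat_mul_s17 hk]
    simp

lemma semicircleIntegral_U_mul_U (d n : ℕ) :
    semicircleIntegral (U (d + (n + 1)) * U (n + 1)) = if d = 0 then 2 else 0 := by
  induction n with
  | zero => simpa [U] using semicircleIntegral_U_succ d
  | succ n ih =>
    rw [← add_assoc, U_succ_mul_U_succ, map_add, ih,
      semicircleIntegral_U_succ (d + (n + 1) + (n + 1)),
      if_neg (show d + (n + 1) + (n + 1) ≠ 0 by omega), add_zero]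

/-- `v` is the semicircle integral of the divided difference of `A` at `z`. -/
def HasDividedIntegral (z : ℝ) (A : ℝ[X]) (v : ℝ) : Prop :=
  ∃ Q : ℝ[X], A - C (A.eval z) = (X - C z) * Q ∧ semicircleIntegral Q = v

lemma HasDividedIntegral.add {z : ℝ} {A B : ℝ[X]} {v w : ℝ} (hA : HasDividedIntegral z A v)
    (hB : HasDividedIntegral z B w) : HasDividedIntegral z (A + B) (v + w) := by
  obtain ⟨P, hP, rfl⟩ := hA
  obtain ⟨Q, hQ, rfl⟩ := hB
  refine ⟨P + Q, ?_, map_add _ _ _⟩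
  rw [eval_add, C_add]
  linear_combination hP + hQ

lemma HasDividedIntegral.integral_eq {z : ℝ} {A : ℝ[X]} {v : ℝ}
    (h : HasDividedIntegral z A v) :
    (1 / π) * ∫ x in (-2 : ℝ)..2,
      ((A.eval x - A.eval z) / (x - z)) * Real.sqrt (4 - x ^ 2) = v := by
  obtain ⟨Q, hQ, rfl⟩ := h
  rw [semicircleIntegral_apply]
  congr 1
  refine intervalIntegral.integral_congr_ae ?_
  filter_upwards [MeasureTheory.Measure.ae_ne MeasureTheory.volume z] with x hx _
  have hx' : x - z ≠ 0 := sub_ne_zero.mpr hx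
  have := congrArg (eval x) hQ
  simp only [eval_sub, eval_mul, eval_X, eval_C] at this
  rw [this, mul_div_cancel_left₀ _ hx']

lemma hasDividedIntegral_U_succ (z : ℝ) (k : ℕ) :
    HasDividedIntegral z (U (k + 1)) (2 * (U k).eval z) := by
  induction k using Nat.twoStepInduction with
  | zero => exact ⟨0, by simp [U], by simp [U]⟩
  | one => exact ⟨U 1, by simp [U], by rw [semicircleIntegral_U_succ 0]; simp [U]⟩
  | more k h₁ h₂ =>
    obtain ⟨P, hP, hv⟩ := h₁
    obtain ⟨Q, hQ, hw⟩ := h₂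
    refine ⟨U (k + 2) + z • Q - P, ?_, ?_⟩
    · rw [U_add_two (k + 1), smul_eq_C_mul]
      simp only [eval_sub, eval_mul, eval_X, C_sub, C_mul]
      linear_combination C z * hQ - hP
    · rw [map_sub, map_add, map_smul, hv, hw, semicircleIntegral_U_succ (k + 1),
        if_neg (Nat.succ_ne_zero k), U_add_two k]
      simp only [eval_sub, eval_mul, eval_X, smul_eq_mul]
      ring

lemma hasDividedIntegral_U_mul_U (z : ℝ) (d n : ℕ) :
    HasDividedIntegral z (U (d + n) * U n)
      (z * (U (d + n) * U n).eval z - (U (d + 2 * n) - U d).eval z) := by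
  induction n with
  | zero => exact ⟨0, by simp [U], by simp [U]⟩
  | succ n ih =>
    rw [← add_assoc, U_succ_mul_U_succ, show d + n + n = d + 2 * n by ring]
    convert ih.add (hasDividedIntegral_U_succ z (d + 2 * n)) using 1
    rw [show d + 2 * (n + 1) = d + 2 * n + 2 by ring, U_add_two (d + 2 * n)]
    simp only [eval_sub, eval_mul, eval_X, eval_add]
    ring

lemma derivative_eq_of_divided_difference {Φ : ℝ[X]} {d n : ℕ}
    (hΦ : ∀ z : ℝ, (derivative Φ).eval z
      = z * (U (d + n) * U n).eval z
        - (1 / π) * ∫ x in (-2 : ℝ)..2,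
            (((U (d + n) * U n).eval x - (U (d + n) * U n).eval z) / (x - z))
              * Real.sqrt (4 - x ^ 2)) :
    derivative Φ = U (d + 2 * n) - U d :=
  Polynomial.funext fun z => by
    rw [hΦ, (hasDividedIntegral_U_mul_U z d n).integral_eq]
    ring

lemma exists_eq_add_C_of_derivative_eq {P Q : ℝ[X]} (h : derivative P = derivative Q) :
    ∃ c, P = Q + C c := by
  have hPQ : derivative (P - Q) = 0 := by rw [derivative_sub, h, sub_self]
  obtain ⟨c, hc⟩ := natDegree_eq_zero.mp (derivative_eq_zero.mp hPQ)
  exact ⟨c, by rw [hc]; ring⟩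

lemma derivative_smul_T {n : ℕ} (hn : n ≠ 0) : derivative ((1 / (n : ℝ)) • T n) = U n := by
  rw [derivative_smul, derivative_T, smul_eq_C_mul, ← mul_assoc, ← C_eq_natCast, ← C_mul,
    one_div_mul_cancel (Nat.cast_ne_zero.mpr hn), C_1, one_mul]

/-- A finitely supported perturbation of `J₀` changes only finitely many columns of `R(J₀)`. -/
lemma eventually_aeval_ez_eq {p q : ℤ → ℝ}
    (hfp : {k : ℤ | p k ≠ 1}.Finite) (hfq : {k : ℤ | q k ≠ 0}.Finite)
    {J J₀ : HZ →L[ℝ] HZ}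
    (hJ : ∀ k : ℤ, J (ez k) = p k • ez (k - 1) + q k • ez k + p (k + 1) • ez (k + 1))
    (hJ₀ : ∀ k : ℤ, J₀ (ez k) = ez (k - 1) + ez (k + 1)) (R : ℝ[X]) :
    ∀ᶠ k in Filter.cofinite, aeval J R (ez k) = aeval J₀ R (ez k) := by
  have hp : ∀ᶠ k in Filter.cofinite, p k = 1 := hfp
  have hq : ∀ᶠ k in Filter.cofinite, q k = 0 := hfq
  have tsucc : Filter.Tendsto (fun k : ℤ => k + 1) Filter.cofinite Filter.cofinite :=
    (add_left_injective 1).tendsto_cofinite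
  have tpred : Filter.Tendsto (fun k : ℤ => k - 1) Filter.cofinite Filter.cofinite :=
    (sub_left_injective (b := 1)).tendsto_cofinite
  have hpow : ∀ n : ℕ, ∀ᶠ k in Filter.cofinite, (J ^ n) (ez k) = (J₀ ^ n) (ez k) := by
    intro n
    induction n with
    | zero => simp
    | succ n ih =>
      filter_upwards [hp, hq, tsucc.eventually hp, tsucc.eventually ih, tpred.eventually ih]
        with k h₁ h₂ h₃ h₄ h₅
      rw [pow_succ, pow_succ, mul_apply_eq_comp, mul_apply_eq_comp,
        hJ, hJ₀, h₁, h₂, h₃]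
      simp only [one_smul, zero_smul, add_zero, map_add, h₄, h₅]
  induction R using Polynomial.induction_on' with
  | add P Q hP hQ =>
    filter_upwards [hP, hQ] with k h₁ h₂
    simp only [map_add, add_apply, h₁, h₂]
  | monomial n a =>
    filter_upwards [hpow n] with k h
    simp only [← smul_X_eq_monomial, map_smul, map_pow, aeval_X, smul_apply, h]

lemma summable_trace_aeval_sub {J J₀ : HZ →L[ℝ] HZ} {R : ℝ[X]}
    (h : ∀ᶠ k in Filter.cofinite, aeval J R (ez k) = aeval J₀ R (ez k)) :
    Summable fun k : ℤ => ⟪(aeval J R - aeval J₀ R) (ez k), ez k⟫ := by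
  refine summable_of_hasFiniteSupport (Set.Finite.subset h ?_)
  intro k hk hk'
  refine hk ?_
  simp only [sub_apply]
  rw [show aeval J R (ez k) = aeval J₀ R (ez k) from hk', sub_self, inner_zero_left]

/-- For `A = U_m U_n` with `m > n ≥ 1`: `a_A = 0` and
`tr(Φ_A(J) - Φ_A(J₀)) = tr(T_{m+n}(J) - T_{m+n}(J₀))/(m+n) - tr(T_{m-n}(J) - T_{m-n}(J₀))/(m-n)`;
for `A = U_n²`: `a_A = 2` and `tr(Φ_A(J) - Φ_A(J₀)) = tr(T_{2n}(J) - T_{2n}(J₀))/(2n)`. -/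
theorem stmt_17
    (p q : ℤ → ℝ) (hp : ∀ k, 0 < p k)
    (hfp : {k : ℤ | p k ≠ 1}.Finite) (hfq : {k : ℤ | q k ≠ 0}.Finite)
    (J J₀ : HZ →L[ℝ] HZ)
    (hJ : ∀ k : ℤ, J (ez k) = p k • ez (k - 1) + q k • ez k + p (k + 1) • ez (k + 1))
    (hJ₀ : ∀ k : ℤ, J₀ (ez k) = ez (k - 1) + ez (k + 1))
    (m n : ℕ) (hn : 1 ≤ n) (hmn : n < m)
    (Φ₁ : Polynomial ℝ)
    (hΦ₁ : ∀ z : ℝ, (derivative Φ₁).eval z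
      = z * (U m * U n).eval z
        - (1 / π) * ∫ x in (-2 : ℝ)..2,
            (((U m * U n).eval x - (U m * U n).eval z) / (x - z)) * Real.sqrt (4 - x ^ 2))
    (Φ₂ : Polynomial ℝ)
    (hΦ₂ : ∀ z : ℝ, (derivative Φ₂).eval z
      = z * (U n * U n).eval z
        - (1 / π) * ∫ x in (-2 : ℝ)..2,
            (((U n * U n).eval x - (U n * U n).eval z) / (x - z)) * Real.sqrt (4 - x ^ 2)) :
    ((1 / π) * (∫ x in (-2 : ℝ)..2, (U m * U n).eval x * Real.sqrt (4 - x ^ 2)) = 0)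
    ∧ (∑' k : ℤ, ⟪(aeval J Φ₁ - aeval J₀ Φ₁) (ez k), ez k⟫)
        = (1 / ((m : ℝ) + n)) *
            (∑' k : ℤ, ⟪(aeval J (T (m + n)) - aeval J₀ (T (m + n))) (ez k), ez k⟫)
          - (1 / ((m : ℝ) - n)) *
            (∑' k : ℤ, ⟪(aeval J (T (m - n)) - aeval J₀ (T (m - n))) (ez k), ez k⟫)
    ∧ ((1 / π) * (∫ x in (-2 : ℝ)..2, (U n * U n).eval x * Real.sqrt (4 - x ^ 2)) = 2)
    ∧ (∑' k : ℤ, ⟪(aeval J Φ₂ - aeval J₀ Φ₂) (ez k), ez k⟫)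
        = (1 / (2 * (n : ℝ))) *
            (∑' k : ℤ, ⟪(aeval J (T (2 * n)) - aeval J₀ (T (2 * n))) (ez k), ez k⟫) := by
  obtain ⟨d, rfl⟩ := Nat.exists_eq_add_of_le' hmn.le
  obtain ⟨r, rfl⟩ := Nat.exists_eq_add_of_le' hn
  have hd : d ≠ 0 := by omega
  have hsum := fun R => summable_trace_aeval_sub (eventually_aeval_ez_eq hfp hfq hJ hJ₀ R)
  refine ⟨?_, ?_, ?_, ?_⟩
  · rw [← semicircleIntegral_apply, semicircleIntegral_U_mul_U, if_neg hd]
  · have hder := derivative_eq_of_divided_difference hΦ₁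
    rw [← derivative_smul_T hd, ← derivative_smul_T (n := d + 2 * (r + 1)) (by omega),
      ← derivative_sub] at hder
    obtain ⟨c, rfl⟩ := exists_eq_add_C_of_derivative_eq hder
    rw [show d + (r + 1) + (r + 1) = d + 2 * (r + 1) by ring, Nat.add_sub_cancel,
      ← tsum_mul_left, ← tsum_mul_left,
      ← ((hsum _).mul_left _).tsum_sub ((hsum _).mul_left _)]
    refine tsum_congr fun k => ?_
    simp only [map_add, map_sub, map_smul, aeval_C, sub_apply,
      add_apply, smul_apply, inner_sub_left,
      inner_add_left, real_inner_smul_left]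
    push_cast
    ring
  · have h := semicircleIntegral_U_mul_U 0 r
    rw [zero_add, if_pos rfl] at h
    rwa [← semicircleIntegral_apply]
  · have hder := derivative_eq_of_divided_difference (d := 0) (n := r + 1) (by simpa using hΦ₂)
    rw [zero_add, U, sub_zero, ← derivative_smul_T (n := 2 * (r + 1)) (by omega)] at hder
    obtain ⟨c, rfl⟩ := exists_eq_add_C_of_derivative_eq hder
    rw [← tsum_mul_left]
    refine tsum_congr fun k => ?_
    simp only [map_add, map_smul, aeval_C, sub_apply,
      add_apply, smul_apply, inner_sub_left,
      inner_add_left, real_inner_smul_left]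
    push_cast
    ring

end
end
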